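/- arXiv:1209.4795 — 4 statements merged into one kernel-verified Lean document; each statement's English description precedes it below -/
import Mathlib

section
/- Let F and G be nonzero homogeneous polynomials in ℂ[x,y,z] of degrees n and m respectively which have no common nonconstant factor. Then the set of points of the complex projective plane ℙ²(ℂ) at which both F and G vanish is finite and has at most n·m elements. -/
open MvPolynomial

noncomputable section

/-- Polynomials in three variables over `ℂ`. -/
abbrev Poly3 : Type := MvPolynomial (Fin 3) ℂ

/-- The complex projective plane `ℙ²(ℂ)`, the projectivization of `ℂ³`. -/
abbrev ProjPlane : Type := Projectivization ℂ (Fin 3 → ℂ)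

/-- A (homogeneous) polynomial vanishes at a projective point if it vanishes at its
canonical nonzero representative vector (for homogeneous polynomials this is equivalent
to vanishing at any nonzero representative vector). -/
def VanishesAt (F : Poly3) (p : ProjPlane) : Prop :=
  MvPolynomial.eval p.rep F = 0

/-- The set of points of `ℙ²(ℂ)` at which `F` vanishes. -/
def zeroSet (F : Poly3) : Set ProjPlane := {p | VanishesAt F p}

/-- Two defining polynomials give the same curve iff they are proportional by a
nonzero scalar. -/
def ProportionalTo (F G : Poly3) : Prop := ∃ c : ℂ, c ≠ 0 ∧ G = c • F

/-- A set of points is collinear if some nonzero homogeneous polynomial of degree 1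
vanishes at all of them. -/
def Collin (s : Set ProjPlane) : Prop :=
  ∃ L : Poly3, L ≠ 0 ∧ L.IsHomogeneous 1 ∧ ∀ p ∈ s, VanishesAt L p

/-- No three distinct points of `s` are collinear. -/
def NoThreeCollinear (s : Set ProjPlane) : Prop :=
  ∀ p q r, p ∈ s → q ∈ s → r ∈ s → p ≠ q → p ≠ r → q ≠ r → ¬ Collin {p, q, r}

/-- `L` is a (the) line through the points `p` and `q`. -/
def IsLineThrough (L : Poly3) (p q : ProjPlane) : Prop :=
  L ≠ 0 ∧ L.IsHomogeneous 1 ∧ VanishesAt L p ∧ VanishesAt L q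

/-- `L` is the generalized Pascal line of the cubics `D₁` and `D₂` with respect to six
points `A, …, F`: the cubics have no common nonconstant factor, their common zero set
consists of exactly nine distinct points (the six given ones plus three further points),
and `L` is the line through the three further intersection points. -/
def IsGenPascalLine (A B C D E F : ProjPlane) (D₁ D₂ L : Poly3) : Prop :=
  IsRelPrime D₁ D₂ ∧ L ≠ 0 ∧ L.IsHomogeneous 1 ∧
    ∃ P Q R : ProjPlane,
      ([A, B, C, D, E, F, P, Q, R] : List ProjPlane).Pairwise (· ≠ ·) ∧
      zeroSet D₁ ∩ zeroSet D₂ = {A, B, C, D, E, F, P, Q, R} ∧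
      VanishesAt L P ∧ VanishesAt L Q ∧ VanishesAt L R

namespace MvPolynomial

variable {σ K : Type*} [Field K]

theorem finrank_homogeneousSubmodule [Fintype σ] (n : ℕ) :
    Module.finrank K (homogeneousSubmodule σ K n) = (Fintype.card σ + n - 1).choose n := by
  classical
  have h : {d : σ →₀ ℕ | d.degree = n} = ↑(Finset.univ.finsuppAntidiag n : Finset (σ →₀ ℕ)) := by
    ext d
    simp [Finsupp.degree_eq_sum]
  have h' := Module.finrank_eq_nat_card_basis
    (basisRestrictSupport K {d : σ →₀ ℕ | d.degree = n})
  rw [homogeneousSubmodule_eq_finsupp_supported]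
  refine h'.trans ?_
  rw [h, Nat.card_coe_set_eq, Set.ncard_coe_finset, Finset.card_finsuppAntidiag_nat_eq_choose,
    Finset.card_univ]

theorem two_mul_finrank_homogeneousSubmodule_fin_three (n : ℕ) :
    2 * Module.finrank K (homogeneousSubmodule (Fin 3) K n) = (n + 1) * (n + 2) := by
  rw [finrank_homogeneousSubmodule, Fintype.card_fin, show 3 + n - 1 = n + 2 by omega,
    Nat.choose_symm_add, Nat.choose_two_right,
    Nat.mul_div_cancel' (Nat.even_mul_pred_self _).two_dvd]
  simp [mul_comm]

instance finiteDimensional_homogeneousSubmodule [Finite σ] (n : ℕ) :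
    FiniteDimensional K (homogeneousSubmodule σ K n) :=
  Module.Finite.iff_fg.2 (homogeneousSubmodule_fg σ K n)

theorem exists_isHomogeneous_one_eval_eq [Fintype σ] (f : (σ → K) →ₗ[K] K) :
    ∃ L : MvPolynomial σ K, L.IsHomogeneous 1 ∧ ∀ v, eval v L = f v := by
  classical
  refine ⟨∑ i, C (f (Pi.single i 1)) * X i,
    IsHomogeneous.sum _ _ _ fun i _ => isHomogeneous_C_mul_X _ _, fun v => ?_⟩
  rw [LinearMap.pi_apply_eq_sum_univ f v]
  have h (i : σ) : (fun j => if i = j then (1 : K) else 0) = Pi.single i 1 := by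
    ext j
    simp [Pi.single_apply, eq_comm]
  simp [h, mul_comm]

theorem exists_isHomogeneous_one_eval_ne_zero [Fintype σ]
    {p q : Projectivization K (σ → K)} (hpq : p ≠ q) :
    ∃ L : MvPolynomial σ K, L.IsHomogeneous 1 ∧ eval p.rep L ≠ 0 ∧ eval q.rep L = 0 := by
  have hp : p.rep ∉ Submodule.span K {q.rep} := fun h => by
    obtain ⟨a, ha⟩ := Submodule.mem_span_singleton.1 h
    apply hpq
    rw [← p.mk_rep, ← q.mk_rep]
    exact (Projectivization.mk_eq_mk_iff' K _ _ p.rep_nonzero q.rep_nonzero).2 ⟨a, ha⟩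
  obtain ⟨f, hfp, hfq⟩ := Submodule.exists_le_ker_of_notMem hp
  obtain ⟨L, hL, hLf⟩ := exists_isHomogeneous_one_eval_eq f
  refine ⟨L, hL, by rwa [hLf], ?_⟩
  rw [hLf]
  exact hfq (Submodule.mem_span_singleton_self _)

theorem exists_isHomogeneous_separating [Fintype σ] (T : Finset (Projectivization K (σ → K)))
    {p : Projectivization K (σ → K)} (hp : p ∉ T) {d : ℕ} (hd : T.card ≤ d) :
    ∃ P : MvPolynomial σ K, P.IsHomogeneous d ∧ eval p.rep P ≠ 0 ∧ ∀ q ∈ T, eval q.rep P = 0 := by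
  obtain ⟨i, hi⟩ := Function.ne_iff.1 p.rep_nonzero
  have h (q : Projectivization K (σ → K)) : ∃ L : MvPolynomial σ K, L.IsHomogeneous 1 ∧
      (p ≠ q → eval p.rep L ≠ 0 ∧ eval q.rep L = 0) := by
    by_cases hpq : p = q
    · exact ⟨X i, isHomogeneous_X _ _, fun h => absurd hpq h⟩
    · obtain ⟨L, hL, h⟩ := exists_isHomogeneous_one_eval_ne_zero hpq
      exact ⟨L, hL, fun _ => h⟩
  choose L hL hLe using h
  have hne : ∀ q ∈ T, p ≠ q := fun q hq h => hp (h ▸ hq)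
  refine ⟨(∏ q ∈ T, L q) * X i ^ (d - T.card), ?_, ?_, fun q hq => ?_⟩
  · have := (IsHomogeneous.prod T L (fun _ => 1) fun q _ => hL q).mul
      (isHomogeneous_X_pow (R := K) i (d - T.card))
    simpa [Nat.add_sub_cancel' hd] using this
  · simp only [map_mul, map_prod, map_pow, eval_X]
    exact mul_ne_zero (Finset.prod_ne_zero_iff.2 fun q hq => (hLe q (hne q hq)).1) (pow_ne_zero _ hi)
  · simp only [map_mul, map_prod]
    rw [Finset.prod_eq_zero hq (hLe q (hne q hq)).2, zero_mul]

/-- Evaluation of polynomials at the chosen representatives of finitely many projective points. -/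
def evalReps (T : Finset (Projectivization K (σ → K))) : MvPolynomial σ K →ₗ[K] (T → K) :=
  LinearMap.pi fun p => (aeval (Projectivization.rep p.1)).toLinearMap

theorem evalReps_apply (T : Finset (Projectivization K (σ → K))) (P : MvPolynomial σ K) (p : T) :
    evalReps T P p = eval p.1.rep P := by
  simp [evalReps, aeval_eq_eval]

theorem map_evalReps_homogeneousSubmodule [Fintype σ] (T : Finset (Projectivization K (σ → K)))
    {d : ℕ} (hd : T.card ≤ d) : (homogeneousSubmodule σ K d).map (evalReps T) = ⊤ := by
  classical
  have h (p : T) : ∃ P : MvPolynomial σ K, P.IsHomogeneous d ∧ eval p.1.rep P ≠ 0 ∧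
      ∀ q ∈ T.erase p.1, eval q.rep P = 0 :=
    exists_isHomogeneous_separating _ (Finset.notMem_erase _ _)
      ((Finset.card_le_card (Finset.erase_subset _ _)).trans hd)
  choose P hP hPp hPq using h
  refine eq_top_iff.2 fun g _ =>
    ⟨∑ p : T, (g p / eval p.1.rep (P p)) • P p, Submodule.sum_mem _ fun p _ =>
      Submodule.smul_mem _ _ (hP p), ?_⟩
  ext q
  rw [evalReps_apply, map_sum, Finset.sum_eq_single q]
  · rw [smul_eval, div_mul_cancel₀ _ (hPp q)]
  · intro p _ hpq
    rw [smul_eval, hPq p q.1 (Finset.mem_erase.2 ⟨fun h => hpq (Subtype.ext h).symm, q.2⟩),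
      mul_zero]
  · simp

theorem card_le_finrank_sub [Fintype σ] (T : Finset (Projectivization K (σ → K)))
    {d : ℕ} (hd : T.card ≤ d) {W : Submodule K (MvPolynomial σ K)}
    (hW : W ≤ homogeneousSubmodule σ K d) (hWT : ∀ P ∈ W, ∀ p ∈ T, eval p.rep P = 0) :
    T.card + Module.finrank K W ≤ Module.finrank K (homogeneousSubmodule σ K d) := by
  set f := (evalReps T).domRestrict (homogeneousSubmodule σ K d)
  have hf : LinearMap.range f = ⊤ := by
    rw [LinearMap.range_domRestrict, map_evalReps_homogeneousSubmodule T hd]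
  rw [← LinearMap.finrank_range_add_finrank_ker f, hf, finrank_top,
    Module.finrank_fintype_fun_eq_card, Fintype.card_coe]
  gcongr
  rw [← (Submodule.comapSubtypeEquivOfLe hW).finrank_eq]
  refine Submodule.finrank_mono fun P hP => ?_
  ext p
  exact (evalReps_apply T _ p).trans (hWT _ hP _ p.2)

theorem IsHomogeneous.exists_of_dvd {P Q : MvPolynomial σ K} {m d : ℕ}
    (hP : P.IsHomogeneous m) (hQ : Q.IsHomogeneous (m + d)) (h : P ∣ Q) :
    ∃ R : MvPolynomial σ K, R.IsHomogeneous d ∧ Q = P * R := by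
  let _ := gradedAlgebra (σ := σ) (R := K)
  obtain ⟨R, rfl⟩ := h
  refine ⟨_, (DirectSum.decompose (homogeneousSubmodule σ K) R d).2, ?_⟩
  rw [← DirectSum.coe_decompose_mul_add_of_left_mem (homogeneousSubmodule σ K) hP,
    DirectSum.decompose_of_mem_same _ hQ]

/-- The multiples of `P` by forms of degree `d`. -/
def homogeneousMultiples (P : MvPolynomial σ K) (d : ℕ) : Submodule K (MvPolynomial σ K) :=
  (homogeneousSubmodule σ K d).map (LinearMap.mulLeft K P)

instance [Finite σ] (P : MvPolynomial σ K) (d : ℕ) :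
    FiniteDimensional K (homogeneousMultiples P d) :=
  inferInstanceAs (FiniteDimensional K ((homogeneousSubmodule σ K d).map (LinearMap.mulLeft K P)))

theorem finrank_homogeneousMultiples {P : MvPolynomial σ K} (hP : P ≠ 0) (d : ℕ) :
    Module.finrank K (homogeneousMultiples P d) =
      Module.finrank K (homogeneousSubmodule σ K d) :=
  ((homogeneousSubmodule σ K d).equivMapOfInjective (LinearMap.mulLeft K P)
    (mul_right_injective₀ hP)).finrank_eq.symm

theorem IsHomogeneous.homogeneousMultiples_le {P : MvPolynomial σ K} {n d e : ℕ}
    (hP : P.IsHomogeneous n) (he : n + d = e) :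
    homogeneousMultiples P d ≤ homogeneousSubmodule σ K e := by
  rintro _ ⟨A, hA, rfl⟩
  exact he ▸ hP.mul hA

theorem homogeneousMultiples_inf_le {F G : MvPolynomial σ K} {m d e : ℕ}
    (hG : G.IsHomogeneous m) (hrp : IsRelPrime F G) :
    homogeneousMultiples F (m + d) ⊓ homogeneousMultiples G e ≤
      homogeneousMultiples (F * G) d := by
  rintro _ ⟨⟨A, hA, rfl⟩, ⟨B, -, hB⟩⟩
  have hdvd : G ∣ F * A := ⟨B, hB.symm⟩
  obtain ⟨R, hR, rfl⟩ := hG.exists_of_dvd hA (hrp.symm.dvd_of_dvd_mul_left hdvd)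
  exact ⟨R, hR, mul_assoc _ _ _⟩

theorem card_le_mul_of_isRelPrime {n m : ℕ} {F G : MvPolynomial (Fin 3) K} (hF : F ≠ 0)
    (hG : G ≠ 0) (hFh : F.IsHomogeneous n) (hGh : G.IsHomogeneous m) (hrp : IsRelPrime F G)
    (T : Finset (Projectivization K (Fin 3 → K)))
    (hT : ∀ p ∈ T, eval p.rep F = 0 ∧ eval p.rep G = 0) : T.card ≤ n * m := by
  set k := T.card
  set W₁ := homogeneousMultiples F (m + k)
  set W₂ := homogeneousMultiples G (n + k)
  have hle : W₁ ⊔ W₂ ≤ homogeneousSubmodule (Fin 3) K (n + m + k) :=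
    sup_le (hFh.homogeneousMultiples_le (by ring)) (hGh.homogeneousMultiples_le (by ring))
  have hvanish : ∀ P ∈ W₁ ⊔ W₂, ∀ p ∈ T, eval p.rep P = 0 := by
    intro P hP p hp
    obtain ⟨_, ⟨A, -, rfl⟩, _, ⟨B, -, rfl⟩, rfl⟩ := Submodule.mem_sup.1 hP
    simp [hT p hp]
  have hcard := card_le_finrank_sub T (show k ≤ n + m + k by omega) hle hvanish
  have hsum := Submodule.finrank_sup_add_finrank_inf_eq W₁ W₂
  have hinf := Submodule.finrank_mono
    (homogeneousMultiples_inf_le (d := k) (e := n + k) hGh hrp)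
  rw [finrank_homogeneousMultiples (mul_ne_zero hF hG)] at hinf
  rw [finrank_homogeneousMultiples hF, finrank_homogeneousMultiples hG] at hsum
  have h₀ := two_mul_finrank_homogeneousSubmodule_fin_three (K := K) k
  have h₁ := two_mul_finrank_homogeneousSubmodule_fin_three (K := K) (m + k)
  have h₂ := two_mul_finrank_homogeneousSubmodule_fin_three (K := K) (n + k)
  have h₃ := two_mul_finrank_homogeneousSubmodule_fin_three (K := K) (n + m + k)
  change Module.finrank K ↥(W₁ ⊓ W₂) ≤ _ at hinf
  nlinarith

end MvPolynomial

/-- **The weak form of Bézout's theorem.** If `F` and `G` are nonzero homogeneous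
polynomials in `ℂ[x,y,z]` of degrees `n` and `m` with no common nonconstant factor,
then their common zero set in `ℙ²(ℂ)` is finite with at most `n·m` points. -/
theorem weak_bezout (n m : ℕ) (F G : Poly3) (hF : F ≠ 0) (hG : G ≠ 0)
    (hFh : F.IsHomogeneous n) (hGh : G.IsHomogeneous m)
    (hrp : IsRelPrime F G) :
    (zeroSet F ∩ zeroSet G).Finite ∧ (zeroSet F ∩ zeroSet G).ncard ≤ n * m := by
  have hbound (T : Finset ProjPlane) (hT : (T : Set ProjPlane) ⊆ zeroSet F ∩ zeroSet G) :
      T.card ≤ n * m :=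
    card_le_mul_of_isRelPrime hF hG hFh hGh hrp T fun _ hp => hT hp
  have hfin : (zeroSet F ∩ zeroSet G).Finite := by
    by_contra hinf
    obtain ⟨T, hTs, hTc⟩ := Set.Infinite.exists_subset_card_eq hinf (n * m + 1)
    have := hbound T hTs
    omega
  refine ⟨hfin, ?_⟩
  rw [Set.ncard_eq_toFinset_card _ hfin]
  exact hbound _ (by simp)
end
end

section
/- Let A, B, C, D, E, F be six distinct points of ℙ²(ℂ) lying on an irreducible conic 𝒞. Let 𝒞₁ be a conic through A, B, C, D and 𝒞₂ a conic through A, B, E, F, whose defining degree-2 polynomials have no common nonconstant factor, and suppose the common zero set of 𝒞₁ and 𝒞₂ consists of exactly four distinct points A, B, X, Y. Suppose the lines l(CD) and l(EF) are distinct and let Z = l(CD) ∩ l(EF). Then X, Y and Z are collinear. -/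
open MvPolynomial

noncomputable section

/-- A homogeneous form of degree one evaluates as a linear functional. -/
lemma exists_linearMap_eval {l : Poly3} (hl : l.IsHomogeneous 1) :
    ∃ φ : (Fin 3 → ℂ) →ₗ[ℂ] ℂ, ∀ w, eval w l = φ w := by
  have hmem : l ∈ Submodule.span ℂ (Set.range (X : Fin 3 → Poly3)) := by
    rw [← homogeneousSubmodule_one_eq_span_X]
    exact hl
  induction hmem using Submodule.span_induction with
  | mem p hp =>
    obtain ⟨i, rfl⟩ := hp
    exact ⟨LinearMap.proj i, fun w => by simp⟩
  | zero => exact ⟨0, fun w => by simp⟩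
  | add p q _ _ ihp ihq =>
    rename_i hp hq
    rw [← homogeneousSubmodule_one_eq_span_X] at hp hq
    obtain ⟨φ, hφ⟩ := ihp hp
    obtain ⟨ψ, hψ⟩ := ihq hq
    exact ⟨φ + ψ, fun w => by simp [hφ, hψ]⟩
  | smul c p _ ihp =>
    rename_i hp
    rw [← homogeneousSubmodule_one_eq_span_X] at hp
    obtain ⟨φ, hφ⟩ := ihp hp
    exact ⟨c • φ, fun w => by simp [hφ]⟩

/-- The restriction of a quadratic form to the span of two vectors is a binary quadratic form. -/
lemma exists_eval_add_smul_eq {Q : Poly3} (hQ : Q.IsHomogeneous 2) (u v : Fin 3 → ℂ) :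
    ∃ β : ℂ, ∀ s t : ℂ,
      eval (s • u + t • v) Q = s ^ 2 * eval u Q + s * t * β + t ^ 2 * eval v Q := by
  have hmem : Q ∈ homogeneousSubmodule (Fin 3) ℂ 1 * homogeneousSubmodule (Fin 3) ℂ 1 := by
    rw [← pow_two, homogeneousSubmodule_one_pow]
    exact hQ
  clear hQ
  induction hmem using Submodule.mul_induction_on' with
  | mem_mul_mem l hl m hm =>
    obtain ⟨φ, hφ⟩ := exists_linearMap_eval hl
    obtain ⟨ψ, hψ⟩ := exists_linearMap_eval hm
    refine ⟨φ u * ψ v + φ v * ψ u, fun s t => ?_⟩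
    simp only [map_mul, hφ, hψ, map_add, map_smul, smul_eq_mul]
    ring
  | add p _ q _ ihp ihq =>
    obtain ⟨β, hβ⟩ := ihp
    obtain ⟨γ, hγ⟩ := ihq
    refine ⟨β + γ, fun s t => ?_⟩
    simp only [map_add, hβ, hγ]
    ring

/-- A nonzero linear form is irreducible. -/
lemma irreducible_of_isHomogeneous_one {l : Poly3} (hl : l.IsHomogeneous 1) (h0 : l ≠ 0) :
    Irreducible l := by
  refine irreducible_of_totalDegree_eq_one (hl.totalDegree h0) fun r hr => ?_
  obtain ⟨d, hd⟩ := ne_zero_iff.mp h0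
  exact (ne_zero_of_dvd_ne_zero hd (hr d)).isUnit

/-- The kernel of a nonzero linear form is spanned by any two independent vectors in it. -/
lemma exists_eq_add_smul {l : Poly3} (hl : l.IsHomogeneous 1) (h0 : l ≠ 0)
    {u v w : Fin 3 → ℂ} (huv : LinearIndependent ℂ ![u, v])
    (hu : eval u l = 0) (hv : eval v l = 0) (hw : eval w l = 0) :
    ∃ s t : ℂ, w = s • u + t • v := by
  obtain ⟨φ, hφ⟩ := exists_linearMap_eval hl
  by_contra hcon
  have hind : LinearIndependent ℂ ![w, u, v] := by
    refine linearIndependent_finCons.mpr ?_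
    refine ⟨huv, fun hmem => hcon ?_⟩
    simp only [Matrix.range_cons, Matrix.range_empty, Set.union_empty,
      Set.singleton_union] at hmem
    obtain ⟨s, t, h⟩ := Submodule.mem_span_pair.mp hmem
    exact ⟨s, t, h.symm⟩
  have hφ0 : φ = 0 := by
    refine (basisOfLinearIndependentOfCardEqFinrank hind (by simp)).ext fun i => ?_
    fin_cases i <;> simp [← hφ, hu, hv, hw]
  refine h0 (hl.eq_zero_of_forall_eval_eq_zero fun w => ?_)
  simp [hφ, hφ0]

/-- A form vanishing on the line `l = 0` is a multiple of `l`, with homogeneous cofactor. -/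
lemma exists_eq_mul_of_forall_eval_eq_zero {l Q : Poly3} {n : ℕ} (hl : l.IsHomogeneous 1)
    (h0 : l ≠ 0) (hQ : Q.IsHomogeneous (1 + n)) (h : ∀ w, eval w l = 0 → eval w Q = 0) :
    ∃ M : Poly3, M.IsHomogeneous n ∧ Q = l * M := by
  have hprime : (Ideal.span {l}).IsPrime :=
    (Ideal.span_singleton_prime h0).mpr (irreducible_of_isHomogeneous_one hl h0).prime
  have hmem : Q ∈ vanishingIdeal ℂ (zeroLocus ℂ (Ideal.span {l})) := by
    rw [zeroLocus_span, mem_vanishingIdeal_iff]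
    intro w hw
    simpa [aeval_eq_eval] using h w (by simpa [aeval_eq_eval] using hw)
  rw [MvPolynomial.IsPrime.vanishingIdeal_zeroLocus, Ideal.mem_span_singleton] at hmem
  obtain ⟨M, rfl⟩ := hmem
  let _ := gradedAlgebra (σ := Fin 3) (R := ℂ)
  refine ⟨DirectSum.decompose (homogeneousSubmodule (Fin 3) ℂ) M n,
    (DirectSum.decompose (homogeneousSubmodule (Fin 3) ℂ) M n).2, ?_⟩
  rw [← DirectSum.coe_decompose_mul_add_of_left_mem (homogeneousSubmodule (Fin 3) ℂ)
    (show l ∈ homogeneousSubmodule (Fin 3) ℂ 1 from hl)]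
  exact (DirectSum.decompose_of_mem_same _ hQ).symm

/-- A quadratic form vanishing at three pairwise independent vectors of a line contains the line. -/
lemma exists_eq_mul_of_quadratic {l Q : Poly3} (hl : l.IsHomogeneous 1) (h0 : l ≠ 0)
    (hQ : Q.IsHomogeneous 2) {u v : Fin 3 → ℂ} (huv : LinearIndependent ℂ ![u, v])
    (hu : eval u l = 0) (hv : eval v l = 0) {s t : ℂ} (hs : s ≠ 0) (ht : t ≠ 0)
    (hQu : eval u Q = 0) (hQv : eval v Q = 0) (hQw : eval (s • u + t • v) Q = 0) :
    ∃ M : Poly3, M.IsHomogeneous 1 ∧ Q = l * M := by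
  refine exists_eq_mul_of_forall_eval_eq_zero (n := 1) hl h0 hQ fun w hw => ?_
  obtain ⟨a, b, rfl⟩ := exists_eq_add_smul hl h0 huv hu hv hw
  obtain ⟨β, hβ⟩ := exists_eval_add_smul_eq hQ u v
  rw [hβ, hQu, hQv] at hQw ⊢
  have : β = 0 := by simpa [hs, ht] using hQw
  simp [this]

/-- Representatives of distinct points are linearly independent. -/
lemma linearIndependent_rep {P Q : ProjPlane} (h : P ≠ Q) :
    LinearIndependent ℂ ![P.rep, Q.rep] := by
  rwa [← Projectivization.independent_mk_iff_LinearIndependent P.rep_nonzero Q.rep_nonzero,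
    P.mk_rep, Q.mk_rep, Projectivization.independent_pair_iff_ne]

/-- Through any two distinct points there is a line. -/
lemma exists_isLineThrough {P Q : ProjPlane} (h : P ≠ Q) : ∃ l, IsLineThrough l P Q := by
  have hn := crossProduct_ne_zero_iff_linearIndependent.mpr (linearIndependent_rep h)
  set n := crossProduct P.rep Q.rep
  have heval : ∀ w, eval w (∑ i, C (n i) * X i : Poly3) = w ⬝ᵥ n := fun w => by
    simp [dotProduct, mul_comm]
  refine ⟨∑ i, C (n i) * X i, fun h0 => hn (funext fun i => ?_),
    IsHomogeneous.sum _ _ _ fun i _ => isHomogeneous_C_mul_X _ _, ?_, ?_⟩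
  · have := heval (Pi.single i 1)
    simpa [h0] using this.symm
  · exact (heval _).trans (dot_self_cross _ _)
  · exact (heval _).trans (dot_cross_self _ _)

/-- A quadratic form vanishing at three distinct points of a line contains the line. -/
lemma exists_eq_mul_of_vanishesAt {l Q : Poly3} {P₁ P₂ P₃ : ProjPlane}
    (hl : IsLineThrough l P₁ P₂) (h₃ : VanishesAt l P₃) (h₁₂ : P₁ ≠ P₂) (h₁₃ : P₁ ≠ P₃)
    (h₂₃ : P₂ ≠ P₃) (hQ : Q.IsHomogeneous 2) (hQ₁ : VanishesAt Q P₁) (hQ₂ : VanishesAt Q P₂)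
    (hQ₃ : VanishesAt Q P₃) :
    ∃ M : Poly3, M.IsHomogeneous 1 ∧ Q = l * M := by
  obtain ⟨h0, hlh, hl₁, hl₂⟩ := hl
  have hind := linearIndependent_rep h₁₂
  obtain ⟨s, t, hst⟩ := exists_eq_add_smul hlh h0 hind hl₁ hl₂ h₃
  have hs : s ≠ 0 := by
    rintro rfl
    have := LinearIndependent.pair_iff.mp (linearIndependent_rep h₂₃) t (-1) (by simp [hst])
    simp at this
  have ht : t ≠ 0 := by
    rintro rfl
    have := LinearIndependent.pair_iff.mp (linearIndependent_rep h₁₃) s (-1) (by simp [hst])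
    simp at this
  exact exists_eq_mul_of_quadratic hlh h0 hQ hind hl₁ hl₂ hs ht hQ₁ hQ₂ (hst ▸ hQ₃)

/-- Two linear forms through the same two points are proportional. -/
lemma exists_eq_C_mul {l M : Poly3} {P Q : ProjPlane} (hPQ : P ≠ Q) (hl : IsLineThrough l P Q)
    (hM : M.IsHomogeneous 1) (hMP : VanishesAt M P) (hMQ : VanishesAt M Q) :
    ∃ c : ℂ, M = C c * l := by
  obtain ⟨h0, hlh, hlP, hlQ⟩ := hl
  obtain ⟨φ, hφ⟩ := exists_linearMap_eval hM
  obtain ⟨N, hN, rfl⟩ := exists_eq_mul_of_forall_eval_eq_zero (n := 0) hlh h0 hM fun w hw => by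
    obtain ⟨a, b, rfl⟩ := exists_eq_add_smul hlh h0 (linearIndependent_rep hPQ) hlP hlQ hw
    unfold VanishesAt at hMP hMQ
    rw [hφ] at hMP hMQ ⊢
    simp [hMP, hMQ]
  rw [← totalDegree_zero_iff_isHomogeneous, totalDegree_eq_zero_iff_eq_C] at hN
  exact ⟨coeff 0 N, by rw [mul_comm, ← hN]⟩

/-- An irreducible quadratic form has no linear factor. -/
lemma not_irreducible_mul {l M : Poly3} (hl : l.IsHomogeneous 1) (hM : M.IsHomogeneous 1) :
    ¬ Irreducible (l * M) := by
  intro h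
  have hl0 : l ≠ 0 := left_ne_zero_of_mul h.ne_zero
  have hM0 : M ≠ 0 := right_ne_zero_of_mul h.ne_zero
  rcases h.isUnit_or_isUnit rfl with hu | hu
  · exact (irreducible_of_isHomogeneous_one hl hl0).not_isUnit hu
  · exact (irreducible_of_isHomogeneous_one hM hM0).not_isUnit hu

/-- Conics through four distinct points `A, B, P, Q` of an irreducible conic `K` lie in the pencil
generated by `K` and the line pair `l(AB) l(PQ)`. -/
lemma exists_eq_C_mul_add {A B P Q : ProjPlane} (hAB : A ≠ B) (hAP : A ≠ P) (hAQ : A ≠ Q)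
    (hBP : B ≠ P) (hBQ : B ≠ Q) (hPQ : P ≠ Q) {K G l m : Poly3} (hK : K.IsHomogeneous 2)
    (hKirr : Irreducible K) (hKA : VanishesAt K A) (hKB : VanishesAt K B) (hKP : VanishesAt K P)
    (hKQ : VanishesAt K Q) (hG : G.IsHomogeneous 2) (hGA : VanishesAt G A) (hGB : VanishesAt G B)
    (hGP : VanishesAt G P) (hGQ : VanishesAt G Q) (hl : IsLineThrough l A B)
    (hm : IsLineThrough m P Q) :
    ∃ a c : ℂ, G = C a * K + C c * (l * m) := by
  have hl0 := hl.1
  have hlh := hl.2.1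
  have hoff : ∀ R, A ≠ R → B ≠ R → VanishesAt K R → ¬ VanishesAt l R := by
    intro R hAR hBR hKR hlR
    obtain ⟨M, hM, rfl⟩ := exists_eq_mul_of_vanishesAt hl hlR hAB hAR hBR hK hKA hKB hKR
    exact not_irreducible_mul hlh hM hKirr
  have hind := linearIndependent_rep hAB
  set w : Fin 3 → ℂ := (1 : ℂ) • A.rep + (1 : ℂ) • B.rep
  have hw : eval w K ≠ 0 := by
    intro hw
    obtain ⟨M, hM, rfl⟩ := exists_eq_mul_of_quadratic hlh hl0 hK hind hl.2.2.1 hl.2.2.2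
      one_ne_zero one_ne_zero hKA hKB hw
    exact not_irreducible_mul hlh hM hKirr
  unfold VanishesAt at *
  set a := eval w G / eval w K
  obtain ⟨M, hM, hGM⟩ := exists_eq_mul_of_quadratic (Q := G - C a * K) hlh hl0
    (hG.sub (hK.C_mul a)) hind hl.2.2.1 hl.2.2.2 one_ne_zero one_ne_zero
    (by simp [hGA, hKA]) (by simp [hGB, hKB])
    (show eval w _ = 0 by simp [a, hw])
  have hM0 : ∀ R : ProjPlane, eval R.rep G = 0 → eval R.rep K = 0 → eval R.rep l ≠ 0 →
      eval R.rep M = 0 := by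
    intro R hGR hKR hlR
    have := congrArg (eval R.rep) hGM
    simpa [hGR, hKR, hlR] using this
  obtain ⟨c, rfl⟩ := exists_eq_C_mul hPQ hm hM (hM0 P hGP hKP (hoff P hAP hBP hKP))
    (hM0 Q hGQ hKQ (hoff Q hAQ hBQ hKQ))
  exact ⟨a, c, by linear_combination hGM⟩

/-- Let `A,…,F` be six distinct points on an irreducible conic, `𝒞₁` a conic through
`A,B,C,D` and `𝒞₂` a conic through `A,B,E,F`, meeting in exactly the four distinct points
`A,B,X,Y`. If `Z` is the intersection point of the distinct lines `l(CD)` and `l(EF)`,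
then `X`, `Y`, `Z` are collinear. -/
theorem residual_points_collinear (A B C D E F X Y Z : ProjPlane)
    (hdist6 : ([A, B, C, D, E, F] : List ProjPlane).Pairwise (· ≠ ·))
    (K : Poly3) (hKh : K.IsHomogeneous 2) (hKirr : Irreducible K)
    (honK : ∀ p ∈ [A, B, C, D, E, F], VanishesAt K p)
    (C₁ C₂ : Poly3) (h1 : C₁ ≠ 0) (h2 : C₂ ≠ 0)
    (h1h : C₁.IsHomogeneous 2) (h2h : C₂.IsHomogeneous 2)
    (hon1 : ∀ p ∈ [A, B, C, D], VanishesAt C₁ p)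
    (hon2 : ∀ p ∈ [A, B, E, F], VanishesAt C₂ p)
    (hrel : IsRelPrime C₁ C₂)
    (hdist4 : ([A, B, X, Y] : List ProjPlane).Pairwise (· ≠ ·))
    (hzero : zeroSet C₁ ∩ zeroSet C₂ = {A, B, X, Y})
    (lCD lEF : Poly3)
    (hlCD : IsLineThrough lCD C D) (hlEF : IsLineThrough lEF E F)
    (hll : ¬ ProportionalTo lCD lEF)
    (hZ : VanishesAt lCD Z ∧ VanishesAt lEF Z) :
    Collin {X, Y, Z} := by
  simp only [List.pairwise_cons, List.mem_cons, List.not_mem_nil, or_false, forall_eq_or_imp,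
    forall_eq] at hdist6 hdist4 honK hon1 hon2
  obtain ⟨⟨hAB, hAC, hAD, hAE, hAF⟩, ⟨hBC, hBD, hBE, hBF⟩, ⟨hCD, -, -⟩, -, hEF, -⟩ := hdist6
  obtain ⟨⟨-, hAX, hAY⟩, ⟨hBX, hBY⟩, -⟩ := hdist4
  obtain ⟨kA, kB, kC, kD, kE, kF⟩ := honK
  obtain ⟨c₁A, c₁B, c₁C, c₁D⟩ := hon1
  obtain ⟨c₂A, c₂B, c₂E, c₂F⟩ := hon2
  obtain ⟨c₁X, c₂X⟩ : X ∈ zeroSet C₁ ∩ zeroSet C₂ := by simp [hzero]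
  obtain ⟨c₁Y, c₂Y⟩ : Y ∈ zeroSet C₁ ∩ zeroSet C₂ := by simp [hzero]
  obtain ⟨l, hl⟩ := exists_isLineThrough hAB
  have hnotdvd : ¬ (l ∣ C₁ ∧ l ∣ C₂) := fun h =>
    (irreducible_of_isHomogeneous_one hl.2.1 hl.1).not_isUnit (hrel h.1 h.2)
  have hoff : ∀ R, A ≠ R → B ≠ R → VanishesAt C₁ R → VanishesAt C₂ R → eval R.rep l ≠ 0 := by
    intro R hAR hBR h₁ h₂ hlR
    obtain ⟨M, -, hM⟩ := exists_eq_mul_of_vanishesAt hl hlR hAB hAR hBR h1h c₁A c₁B h₁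
    obtain ⟨N, -, hN⟩ := exists_eq_mul_of_vanishesAt hl hlR hAB hAR hBR h2h c₂A c₂B h₂
    exact hnotdvd ⟨⟨M, hM⟩, ⟨N, hN⟩⟩
  obtain ⟨a, c, hC₁⟩ := exists_eq_C_mul_add hAB hAC hAD hBC hBD hCD hKh hKirr kA kB kC kD
    h1h c₁A c₁B c₁C c₁D hl hlCD
  obtain ⟨b, d, hC₂⟩ := exists_eq_C_mul_add hAB hAE hAF hBE hBF hEF hKh hKirr kA kB kE kF
    h2h c₂A c₂B c₂E c₂F hl hlEF
  have hcomb : MvPolynomial.C b * C₁ - MvPolynomial.C a * C₂ =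
      l * (MvPolynomial.C (b * c) * lCD - MvPolynomial.C (a * d) * lEF) := by
    rw [hC₁, hC₂, C_mul, C_mul]
    ring
  have hres : ∀ R : ProjPlane, A ≠ R → B ≠ R → VanishesAt C₁ R → VanishesAt C₂ R →
      VanishesAt (MvPolynomial.C (b * c) * lCD - MvPolynomial.C (a * d) * lEF) R := by
    intro R hAR hBR h₁ h₂
    have hlR := hoff R hAR hBR h₁ h₂
    have := congrArg (eval R.rep) hcomb
    unfold VanishesAt at h₁ h₂ ⊢
    rw [map_mul, map_sub, map_mul, map_mul, h₁, h₂, mul_zero, mul_zero, sub_zero] at this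
    exact (mul_eq_zero.mp this.symm).resolve_left hlR
  refine ⟨MvPolynomial.C (b * c) * lCD - MvPolynomial.C (a * d) * lEF, fun hL => ?_,
    (hlCD.2.1.C_mul _).sub (hlEF.2.1.C_mul _), ?_⟩
  · rw [sub_eq_zero] at hL
    by_cases had : a * d = 0
    · have hbc : b * c = 0 := by simpa [had, hlCD.1] using hL
      rcases mul_eq_zero.mp had with rfl | rfl <;> rcases mul_eq_zero.mp hbc with rfl | rfl
      · exact hnotdvd ⟨⟨MvPolynomial.C c * lCD, by rw [hC₁, C_0]; ring⟩,
          ⟨MvPolynomial.C d * lEF, by rw [hC₂, C_0]; ring⟩⟩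
      · exact h1 (by simp [hC₁])
      · exact h2 (by simp [hC₂])
      · exact hKirr.not_isUnit (hrel ⟨MvPolynomial.C a, by rw [hC₁, C_0]; ring⟩
          ⟨MvPolynomial.C b, by rw [hC₂, C_0]; ring⟩)
    · have hEF' : lEF = (b * c / (a * d)) • lCD := by
        rw [smul_eq_C_mul, div_eq_inv_mul, C_mul, mul_assoc, hL, ← mul_assoc, ← C_mul,
          inv_mul_cancel₀ had, C_1, one_mul]
      refine hll ⟨b * c / (a * d), fun h => hlEF.1 ?_, hEF'⟩
      rw [hEF', h, zero_smul]
  · rintro R (rfl | rfl | rfl)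
    · exact hres _ hAX hBX c₁X c₂X
    · exact hres _ hAY hBY c₁Y c₂Y
    · have h₁ := hZ.1
      have h₂ := hZ.2
      unfold VanishesAt at h₁ h₂ ⊢
      simp [h₁, h₂]
end
end

section
/- (The generalized Steiner–Kirkman point) Let A, B, C, D, E, F be six distinct points of ℙ²(ℂ) on an irreducible conic 𝒞, and let 𝒟₁, 𝒟₂, 𝒟₃ be three cubics through all six points such that each of the three pairs (𝒟₂,𝒟₃), (𝒟₁,𝒟₃), (𝒟₁,𝒟₂) satisfies the hypotheses for a generalized Pascal line; let p₁, p₂, p₃ be the generalized Pascal lines of these three pairs respectively. Then there is a point of ℙ²(ℂ) lying on all three lines p₁, p₂, p₃ (the three lines belong to one pencil). -/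
open MvPolynomial

noncomputable section

/-! ### Polynomial forms on `ℂ³` -/

theorem eval_smul_of_isHomogeneous {G : Poly3} {n : ℕ} (hG : G.IsHomogeneous n) (c : ℂ)
    (v : Fin 3 → ℂ) : eval (c • v) G = c ^ n * eval v G := by
  rw [eval_eq, eval_eq, Finset.mul_sum]
  refine Finset.sum_congr rfl fun d hd => ?_
  have hdeg := hG.degree_eq_sum_deg_support hd
  simp only [Pi.smul_apply, smul_eq_mul, mul_pow, Finset.prod_mul_distrib,
    Finset.prod_pow_eq_pow_sum]
  rw [← hdeg]
  ring

theorem dual_apply_eq_sum (f : Module.Dual ℂ (Fin 3 → ℂ)) (v : Fin 3 → ℂ) :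
    f v = ∑ j, f (Pi.single j 1) * v j := by
  conv_lhs => rw [← Finset.univ_sum_single v, map_sum]
  refine Finset.sum_congr rfl fun j _ => ?_
  rw [mul_comm, ← smul_eq_mul, ← map_smul, ← Pi.single_smul, smul_eq_mul, mul_one]

theorem exists_dual_eval_eq {L : Poly3} (hL : L.IsHomogeneous 1) :
    ∃ f : Module.Dual ℂ (Fin 3 → ℂ), ∀ v, eval v L = f v := by
  have hL' : L ∈ homogeneousSubmodule (Fin 3) ℂ 1 := hL
  rw [homogeneousSubmodule_one_eq_span_X] at hL'
  clear hL
  induction hL' using Submodule.span_induction with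
  | mem x hx =>
    obtain ⟨i, rfl⟩ := hx
    exact ⟨LinearMap.proj i, fun v => by simp⟩
  | zero => exact ⟨0, fun v => by simp⟩
  | add x y _ _ hx hy =>
    obtain ⟨f, hf⟩ := hx
    obtain ⟨g, hg⟩ := hy
    exact ⟨f + g, fun v => by simp [hf, hg]⟩
  | smul a x _ hx =>
    obtain ⟨f, hf⟩ := hx
    exact ⟨a • f, fun v => by simp [hf]⟩

theorem eval_quadratic_combination {K : Poly3} (hK : K.IsHomogeneous 2) (u v w : Fin 3 → ℂ) :
    ∃ p q r : ℂ, ∀ x y z : ℂ, eval (x • u + y • v + z • w) K =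
      x ^ 2 * eval u K + y ^ 2 * eval v K + z ^ 2 * eval w K
        + x * y * p + x * z * q + y * z * r := by
  have hK' : K ∈ homogeneousSubmodule (Fin 3) ℂ 2 := hK
  rw [← homogeneousSubmodule_one_pow, pow_two] at hK'
  clear hK
  induction hK' using Submodule.mul_induction_on' with
  | mem_mul_mem m hm n hn =>
    obtain ⟨f, hf⟩ := exists_dual_eval_eq hm
    obtain ⟨g, hg⟩ := exists_dual_eval_eq hn
    refine ⟨f u * g v + f v * g u, f u * g w + f w * g u, f v * g w + f w * g v,
      fun x y z => ?_⟩
    simp only [map_mul, hf, hg, map_add, map_smul, smul_eq_mul]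
    ring
  | add a _ b _ ha hb =>
    obtain ⟨p, q, r, h⟩ := ha
    obtain ⟨p', q', r', h'⟩ := hb
    refine ⟨p + p', q + q', r + r', fun x y z => ?_⟩
    simp only [map_add, h, h']
    ring

theorem Irreducible.not_forall_eval_eq_mul {K : Poly3} (hK : Irreducible K)
    (f g : Module.Dual ℂ (Fin 3 → ℂ)) : ¬ ∀ v, eval v K = f v * g v := by
  intro h
  have key : ∀ f : Module.Dual ℂ (Fin 3 → ℂ), ∃ L : Poly3, (∀ v, eval v L = f v) ∧ ¬ IsUnit L := by
    intro f
    have hev : ∀ v, eval v (∑ i, C (f (Pi.single i 1)) * X i : Poly3) = f v := by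
      intro v
      simp [dual_apply_eq_sum f v]
    refine ⟨_, hev, fun hu => ?_⟩
    have := hu.map (eval (0 : Fin 3 → ℂ))
    rw [hev, map_zero] at this
    exact not_isUnit_zero this
  obtain ⟨L, hL, hLu⟩ := key f
  obtain ⟨M, hM, hMu⟩ := key g
  have : K = L * M := MvPolynomial.funext fun v => by rw [h, map_mul, hL, hM]
  exact (hK.isUnit_or_isUnit this).elim hLu hMu

theorem isHomogeneous_one_of_mul {K M : Poly3} (hK : K.IsHomogeneous 2) (hK0 : K ≠ 0)
    (hKM : (K * M).IsHomogeneous 3) : M.IsHomogeneous 1 := by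
  let : GradedRing (homogeneousSubmodule (Fin 3) ℂ) := MvPolynomial.gradedAlgebra
  have h := DirectSum.coe_decompose_mul_add_of_left_mem (homogeneousSubmodule (Fin 3) ℂ)
    (i := 2) (j := 1) (b := M) hK
  rw [DirectSum.decompose_of_mem_same _
    (show K * M ∈ homogeneousSubmodule (Fin 3) ℂ (2 + 1) from hKM)] at h
  rw [mul_left_cancel₀ hK0 h]
  exact (DirectSum.decompose (homogeneousSubmodule (Fin 3) ℂ) M 1).2

/-! ### Linear algebra -/

theorem exists_basis_of_ne {P Q : ProjPlane} (h : P ≠ Q) :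
    ∃ b : Module.Basis (Fin 3) ℂ (Fin 3 → ℂ), b 0 = P.rep ∧ b 1 = Q.rep := by
  have hli : LinearIndependent ℂ ![P.rep, Q.rep] := by
    rw [LinearIndependent.pair_iff' P.rep_nonzero]
    intro a ha
    apply h
    rw [← P.mk_rep, ← Q.mk_rep, eq_comm, Projectivization.mk_eq_mk_iff']
    exact ⟨a, ha⟩
  obtain ⟨w, hw⟩ := exists_linearIndependent_snoc_of_lt_finrank hli (by simp)
  refine ⟨basisOfLinearIndependentOfCardEqFinrank hw (by simp), ?_, ?_⟩ <;>
    rw [coe_basisOfLinearIndependentOfCardEqFinrank] <;> rfl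

theorem dual_apply_eq_zero_iff {P Q : ProjPlane} (h : P ≠ Q)
    {f g : Module.Dual ℂ (Fin 3 → ℂ)} (hf : f ≠ 0) (hg : g ≠ 0)
    (hfP : f P.rep = 0) (hfQ : f Q.rep = 0) (hgP : g P.rep = 0) (hgQ : g Q.rep = 0)
    (v : Fin 3 → ℂ) : f v = 0 ↔ g v = 0 := by
  obtain ⟨b, hP, hQ⟩ := exists_basis_of_ne h
  rw [← hP] at hfP hgP
  rw [← hQ] at hfQ hgQ
  have key : ∀ f : Module.Dual ℂ (Fin 3 → ℂ), f ≠ 0 → f (b 0) = 0 → f (b 1) = 0 →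
      (f v = 0 ↔ b.repr v 2 = 0) := by
    intro f hf h0 h1
    have h2 : f (b 2) ≠ 0 := fun h2 => hf <| b.ext fun i => by fin_cases i <;> simp [h0, h1, h2]
    conv_lhs => rw [← b.sum_repr v, map_sum, Fin.sum_univ_three]
    simp [h0, h1, h2]
  rw [key f hf hfP hfQ, key g hg hgP hgQ]

theorem exists_ne_zero_of_dual_dependent {f₁ f₂ f₃ : Module.Dual ℂ (Fin 3 → ℂ)} {c₁ c₂ c₃ : ℂ}
    (hc : c₁ ≠ 0 ∨ c₂ ≠ 0 ∨ c₃ ≠ 0) (h : ∀ v, c₁ * f₁ v + c₂ * f₂ v + c₃ * f₃ v = 0) :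
    ∃ v : Fin 3 → ℂ, v ≠ 0 ∧ f₁ v = 0 ∧ f₂ v = 0 ∧ f₃ v = 0 := by
  have key : ∀ f g : Module.Dual ℂ (Fin 3 → ℂ), ∃ v : Fin 3 → ℂ, v ≠ 0 ∧ f v = 0 ∧ g v = 0 := by
    intro f g
    have hker : LinearMap.ker (f.prod g) ≠ ⊥ := LinearMap.ker_ne_bot_of_finrank_lt (by simp)
    obtain ⟨v, hv, hv0⟩ := Submodule.exists_mem_ne_zero_of_ne_bot hker
    exact ⟨v, hv0, Prod.mk_eq_zero.1 hv⟩
  rcases hc with hc | hc | hc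
  · obtain ⟨v, hv, h2, h3⟩ := key f₂ f₃
    exact ⟨v, hv, by simpa [h2, h3, hc] using h v, h2, h3⟩
  · obtain ⟨v, hv, h1, h3⟩ := key f₁ f₃
    exact ⟨v, hv, h1, by simpa [h1, h3, hc] using h v, h3⟩
  · obtain ⟨v, hv, h1, h2⟩ := key f₁ f₂
    exact ⟨v, hv, h1, h2, by simpa [h1, h2, hc] using h v⟩

/-! ### Irreducible conics -/

theorem exists_conic_normal_form {K : Poly3} (hKh : K.IsHomogeneous 2) (hK : Irreducible K)
    {A B : ProjPlane} (hAB : A ≠ B) (hA : VanishesAt K A) (hB : VanishesAt K B) :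
    ∃ e : (Fin 3 → ℂ) ≃ₗ[ℂ] (Fin 3 → ℂ), ∀ v, eval v K = e v 0 * e v 1 - e v 2 ^ 2 := by
  obtain ⟨b, hbA, hbB⟩ := exists_basis_of_ne hAB
  obtain ⟨p, q, r, h⟩ := eval_quadratic_combination hKh (b 0) (b 1) (b 2)
  have hA' : eval (b 0) K = 0 := by rw [hbA]; exact hA
  have hB' : eval (b 1) K = 0 := by rw [hbB]; exact hB
  set s := eval (b 2) K
  have hev : ∀ v, eval v K = p * (b.coord 0 v * b.coord 1 v) + q * (b.coord 0 v * b.coord 2 v)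
      + r * (b.coord 1 v * b.coord 2 v) + s * b.coord 2 v ^ 2 := by
    intro v
    have hv : v = b.coord 0 v • b 0 + b.coord 1 v • b 1 + b.coord 2 v • b 2 := by
      conv_lhs => rw [← b.sum_repr v, Fin.sum_univ_three]
      rfl
    conv_lhs => rw [hv, h, hA', hB']
    ring
  have hp : p ≠ 0 := by
    rintro rfl
    refine hK.not_forall_eval_eq_mul (b.coord 2) (q • b.coord 0 + r • b.coord 1 + s • b.coord 2)
      fun v => ?_
    rw [hev]
    simp only [LinearMap.add_apply, LinearMap.smul_apply, smul_eq_mul]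
    ring
  obtain ⟨κ, hκ⟩ := IsAlgClosed.exists_pow_nat_eq (q * r / p - s) two_pos
  let f : Module.Dual ℂ (Fin 3 → ℂ) := p • b.coord 0 + r • b.coord 2
  let g : Module.Dual ℂ (Fin 3 → ℂ) := b.coord 1 + (q / p) • b.coord 2
  have hfg : ∀ v, eval v K = f v * g v - (κ * b.coord 2 v) ^ 2 := by
    intro v
    rw [hev, mul_pow, hκ]
    simp only [f, g, LinearMap.add_apply, LinearMap.smul_apply, smul_eq_mul]
    field_simp
    ring
  have hκ0 : κ ≠ 0 := by
    rintro rfl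
    exact hK.not_forall_eval_eq_mul f g fun v => by rw [hfg]; ring
  let φ : (Fin 3 → ℂ) →ₗ[ℂ] (Fin 3 → ℂ) := LinearMap.pi ![f, g, κ • b.coord 2]
  have hφ : Function.Injective φ := by
    rw [← LinearMap.ker_eq_bot, LinearMap.ker_eq_bot']
    intro v hv
    have h0 : f v = 0 := congrFun hv 0
    have h1 : g v = 0 := congrFun hv 1
    have h2 : κ * b.coord 2 v = 0 := congrFun hv 2
    have h2' : b.coord 2 v = 0 := by simpa [hκ0] using h2
    have h0' : b.coord 0 v = 0 := by simpa [f, h2', hp, -Module.Basis.coord_apply] using h0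
    have h1' : b.coord 1 v = 0 := by simpa [g, h2', -Module.Basis.coord_apply] using h1
    refine b.ext_elem fun i => ?_
    fin_cases i <;> simpa
  exact ⟨LinearEquiv.ofInjectiveEndo φ hφ, hfg⟩

theorem exists_conic_parameters {K : Poly3} {e : (Fin 3 → ℂ) ≃ₗ[ℂ] (Fin 3 → ℂ)}
    (he : ∀ v, eval v K = e v 0 * e v 1 - e v 2 ^ 2) {v : Fin 3 → ℂ} (hv : eval v K = 0) :
    ∃ s t : ℂ, v = e.symm ![s ^ 2, t ^ 2, s * t] := by
  rw [he, sub_eq_zero] at hv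
  obtain ⟨s, hs⟩ := IsAlgClosed.exists_pow_nat_eq (e v 0) two_pos
  obtain ⟨t, ht⟩ := IsAlgClosed.exists_pow_nat_eq (e v 1) two_pos
  have hst : e v 2 = s * t ∨ e v 2 = -(s * t) := by
    rw [← sq_eq_sq_iff_eq_or_eq_neg, ← hv, ← hs, ← ht]; ring
  rcases hst with h | h
  · refine ⟨s, t, ?_⟩
    rw [LinearEquiv.eq_symm_apply]
    ext i
    fin_cases i <;> simp [hs, ht, h]
  · refine ⟨s, -t, ?_⟩
    rw [LinearEquiv.eq_symm_apply]
    ext i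
    fin_cases i <;> simp [hs, ht, h]

/-- Finitely many points of a parametrised conic can be moved away from infinity. -/
theorem exists_slope_avoiding (S : Finset (ℂ × ℂ)) :
    ∃ k : ℂ, ∀ x ∈ S, x ≠ 0 → x.2 ≠ k * x.1 := by
  obtain ⟨k, hk⟩ := Infinite.exists_notMem_finset (S.image fun x => x.2 / x.1)
  refine ⟨k, fun x hx hx0 h => ?_⟩
  by_cases h1 : x.1 = 0
  · exact hx0 (Prod.ext h1 (by rw [h, h1, mul_zero]; rfl))
  · exact hk (Finset.mem_image.2 ⟨x, hx, by rw [h, mul_div_cancel_right₀ _ h1]⟩)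

theorem dvd_of_forall_eval_eq_zero {K G : Poly3} (hK : Irreducible K)
    (h : ∀ v, eval v K = 0 → eval v G = 0) : K ∣ G := by
  have hprime : (Ideal.span {K}).IsPrime :=
    (Ideal.span_singleton_prime hK.ne_zero).2 hK.prime
  rw [← Ideal.mem_span_singleton, ← IsPrime.vanishingIdeal_zeroLocus (K := ℂ) (Ideal.span {K})]
  intro v hv
  exact h v (hv K (Ideal.mem_span_singleton_self K))

theorem conic_dvd_cubic {K G : Poly3} (hKh : K.IsHomogeneous 2) (hK : Irreducible K)
    (hG : G.IsHomogeneous 3) (S : Finset ProjPlane) (hS : 7 ≤ S.card)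
    (hSK : ∀ p ∈ S, VanishesAt K p) (hSG : ∀ p ∈ S, VanishesAt G p) : K ∣ G := by
  classical
  obtain ⟨A, hA, B, hB, hAB⟩ := Finset.one_lt_card.1 (by omega : 1 < S.card)
  obtain ⟨e, he⟩ := exists_conic_normal_form hKh hK hAB (hSK A hA) (hSK B hB)
  refine dvd_of_forall_eval_eq_zero hK fun v hv => ?_
  obtain ⟨s₀, t₀, hst₀⟩ := exists_conic_parameters he hv
  choose! s t hst using fun p : ProjPlane =>
    fun hp : p ∈ S => exists_conic_parameters he (hSK p hp)
  obtain ⟨k, hk⟩ := exists_slope_avoiding (insert (s₀, t₀) (S.image fun p => (s p, t p)))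
  let ψ : ℂ → Fin 3 → ℂ := fun τ => e.symm ![τ ^ 2, (1 + k * τ) ^ 2, τ * (1 + k * τ)]
  have hψ : ∀ a b : ℂ, b ≠ k * a →
      e.symm ![a ^ 2, b ^ 2, a * b] = (b - k * a) ^ 2 • ψ (a / (b - k * a)) := by
    intro a b hab
    have hab' : b - k * a ≠ 0 := sub_ne_zero.2 hab
    obtain ⟨d, rfl⟩ : ∃ d, b = d + k * a := ⟨b - k * a, by ring⟩
    rw [add_sub_cancel_right] at hab' ⊢
    simp only [ψ, ← map_smul]
    congr 1
    ext i
    fin_cases i <;> simp <;> field_simp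
  let F : Polynomial ℂ := aeval (fun i => ∑ j, Polynomial.C (e.symm (Pi.single j 1) i) *
    (![Polynomial.X ^ 2, (1 + Polynomial.C k * Polynomial.X) ^ 2,
      Polynomial.X * (1 + Polynomial.C k * Polynomial.X)] : Fin 3 → Polynomial ℂ) j) G
  have hFdeg : F.natDegree ≤ 3 * 2 := by
    refine aeval_natDegree_le G hG.totalDegree_le _ fun i => ?_
    refine Polynomial.natDegree_sum_le_of_forall_le _ _ fun j _ => ?_
    refine (Polynomial.natDegree_C_mul_le _ _).trans ?_
    fin_cases j <;> simp <;> compute_degree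
  have hFeval : ∀ τ, F.eval τ = eval (ψ τ) G := by
    intro τ
    have hψ' : ψ τ = fun i => ∑ j, e.symm (Pi.single j 1) i *
        (![τ ^ 2, (1 + k * τ) ^ 2, τ * (1 + k * τ)] : Fin 3 → ℂ) j := by
      ext i
      exact dual_apply_eq_sum (LinearMap.proj i ∘ₗ e.symm.toLinearMap) _
    rw [hψ', ← Polynomial.coe_aeval_eq_eval, ← MvPolynomial.aeval_eq_eval]
    simp only [F, MvPolynomial.comp_aeval_apply]
    congr 2
    ext i
    simp only [map_sum, map_mul, Polynomial.aeval_C]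
    refine Finset.sum_congr rfl fun j _ => ?_
    fin_cases j <;> simp
  have hne : ∀ p ∈ S, t p ≠ k * s p := by
    intro p hp
    refine hk _ (Finset.mem_insert_of_mem (Finset.mem_image_of_mem _ hp)) fun h0 => ?_
    obtain ⟨h1, h2⟩ := Prod.mk_eq_zero.1 h0
    apply p.rep_nonzero
    rw [hst p hp, h1, h2, LinearEquiv.map_eq_zero_iff]
    ext i
    fin_cases i <;> simp
  have hF : F = 0 := by
    refine Polynomial.eq_zero_of_natDegree_lt_card_of_eval_eq_zero F (ι := S)
      (f := fun p => s p / (t p - k * s p)) ?_ ?_ ?_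
    · rintro ⟨p, hp⟩ ⟨q, hq⟩ hpq
      have hp' := (hst p hp).trans (hψ _ _ (hne p hp))
      have hq' := (hst q hq).trans (hψ _ _ (hne q hq))
      simp only at hpq
      rw [← hpq] at hq'
      rw [Subtype.mk.injEq, ← p.mk_rep, ← q.mk_rep, Projectivization.mk_eq_mk_iff']
      refine ⟨(t p - k * s p) ^ 2 / (t q - k * s q) ^ 2, ?_⟩
      have := sub_ne_zero.2 (hne q hq)
      rw [hp', hq', smul_smul]
      congr 1
      field_simp
    · rintro ⟨p, hp⟩
      have h := hSG p hp
      rw [VanishesAt, hst p hp, hψ _ _ (hne p hp), eval_smul_of_isHomogeneous hG] at h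
      rw [hFeval]
      simpa [sub_ne_zero.2 (hne p hp)] using h
    · rw [Fintype.card_coe]
      omega
  by_cases h0 : (s₀, t₀) = 0
  · obtain ⟨rfl, rfl⟩ := Prod.mk_eq_zero.1 h0
    have hv0 : v = (0 : ℂ) • v := by
      rw [zero_smul, hst₀, LinearEquiv.map_eq_zero_iff]
      ext i
      fin_cases i <;> simp
    rw [hv0, eval_smul_of_isHomogeneous hG]
    simp
  · rw [hst₀, hψ _ _ (hk _ (Finset.mem_insert_self _ _) h0), eval_smul_of_isHomogeneous hG,
      ← hFeval, hF]
    simp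

theorem exists_conic_point_notMem {K : Poly3} (hKh : K.IsHomogeneous 2) (hK : Irreducible K)
    (S : Finset ProjPlane) (hS : 2 ≤ S.card) (hSK : ∀ p ∈ S, VanishesAt K p) :
    ∃ T, VanishesAt K T ∧ T ∉ S := by
  classical
  obtain ⟨A, hA, B, hB, hAB⟩ := Finset.one_lt_card.1 (by omega : 1 < S.card)
  obtain ⟨e, he⟩ := exists_conic_normal_form hKh hK hAB (hSK A hA) (hSK B hB)
  let w : ℂ → Fin 3 → ℂ := fun k => e.symm ![1, k ^ 2, k]
  have hw : ∀ k, w k ≠ 0 := by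
    intro k hk
    rw [LinearEquiv.map_eq_zero_iff] at hk
    simpa using congrFun hk 0
  obtain ⟨T, ⟨k, rfl⟩, hT⟩ := Set.Infinite.exists_notMem_finset
    (Set.infinite_range_of_injective (f := fun k => Projectivization.mk ℂ (w k) (hw k)) (by
      intro k l hkl
      obtain ⟨a, ha⟩ := (Projectivization.mk_eq_mk_iff' ℂ _ _ _ _).1 hkl
      rw [← map_smul, e.symm.injective.eq_iff] at ha
      have h0 : a = 1 := by simpa using congrFun ha 0
      have h2 : a * l = k := congrFun ha 2
      rw [← h2, h0, one_mul])) S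
  refine ⟨_, ?_, hT⟩
  obtain ⟨a, ha⟩ := Projectivization.exists_smul_eq_mk_rep ℂ (w k) (hw k)
  rw [VanishesAt, ← ha, Units.smul_def, eval_smul_of_isHomogeneous hKh, he]
  simp [w]

/-! ### The pencil generated by two cubics -/

/-- The residual line of the member of the pencil generated by `D₁` and `D₂` that contains the
conic `K` is the generalized Pascal line. -/
theorem IsGenPascalLine.exists_conic_mul_eq {A B C D E F T : ProjPlane} {K D₁ D₂ p : Poly3}
    (hp : IsGenPascalLine A B C D E F D₁ D₂ p)
    (hdist : ([A, B, C, D, E, F] : List ProjPlane).Pairwise (· ≠ ·))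
    (hKh : K.IsHomogeneous 2) (hK : Irreducible K)
    (honK : ∀ q ∈ [A, B, C, D, E, F], VanishesAt K q)
    (hD₁ : D₁.IsHomogeneous 3) (hD₂ : D₂.IsHomogeneous 3)
    (hz₁ : ∀ q ∈ [A, B, C, D, E, F], VanishesAt D₁ q)
    (hz₂ : ∀ q ∈ [A, B, C, D, E, F], VanishesAt D₂ q)
    (hTK : VanishesAt K T) (hT : T ∉ [A, B, C, D, E, F]) :
    (eval T.rep D₁ ≠ 0 ∨ eval T.rep D₂ ≠ 0) ∧
    ∃ M : Poly3, M.IsHomogeneous 1 ∧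
      K * M = MvPolynomial.C (eval T.rep D₁) * D₂ - MvPolynomial.C (eval T.rep D₂) * D₁ ∧
      ∀ v, eval v M = 0 ↔ eval v p = 0 := by
  classical
  obtain ⟨hrel, hp0, hph, P, Q, R, hpair, hzero, hpP, hpQ, -⟩ := hp
  have dvd_of_seventh : ∀ X ∉ [A, B, C, D, E, F], VanishesAt K X → ∀ G : Poly3,
      G.IsHomogeneous 3 → (∀ q ∈ [A, B, C, D, E, F], VanishesAt G q) → VanishesAt G X →
      K ∣ G := by
    intro X hX hXK G hG hGz hGX
    have hnodup : (X :: [A, B, C, D, E, F]).Nodup := List.nodup_cons.2 ⟨hX, hdist⟩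
    refine conic_dvd_cubic hKh hK hG (X :: [A, B, C, D, E, F]).toFinset ?_ ?_ ?_
    · rw [List.toFinset_card_of_nodup hnodup]; rfl
    all_goals
      intro q hq
      rcases List.mem_cons.1 (List.mem_toFinset.1 hq) with rfl | hq
      · assumption
      · solve_by_elim
  have not_both : ∀ X ∉ [A, B, C, D, E, F], VanishesAt K X →
      ¬ (VanishesAt D₁ X ∧ VanishesAt D₂ X) := fun X hX hXK h =>
    hK.not_isUnit (hrel (dvd_of_seventh X hX hXK D₁ hD₁ hz₁ h.1)
      (dvd_of_seventh X hX hXK D₂ hD₂ hz₂ h.2))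
  have hne : eval T.rep D₁ ≠ 0 ∨ eval T.rep D₂ ≠ 0 := by
    rw [← not_and_or]
    exact not_both T hT hTK
  obtain ⟨M, hM⟩ : K ∣ MvPolynomial.C (eval T.rep D₁) * D₂ -
      MvPolynomial.C (eval T.rep D₂) * D₁ := by
    refine dvd_of_seventh T hT hTK _ ((hD₂.C_mul _).sub (hD₁.C_mul _)) ?_ ?_
    · intro q hq
      have h1 : eval q.rep D₁ = 0 := hz₁ q hq
      have h2 : eval q.rep D₂ = 0 := hz₂ q hq
      simp [VanishesAt, h1, h2]
    · simp [VanishesAt, mul_comm]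
  have hMh : M.IsHomogeneous 1 := isHomogeneous_one_of_mul hKh hK.ne_zero
    (hM ▸ (hD₂.C_mul _).sub (hD₁.C_mul _))
  have not_unit : ∀ G : Poly3, G.IsHomogeneous 3 → ¬ IsUnit G := by
    intro G hG hu
    have := hu.map (eval ((0 : ℂ) • (0 : Fin 3 → ℂ)))
    rw [eval_smul_of_isHomogeneous hG] at this
    simp at this
  have hM0 : M ≠ 0 := by
    rintro rfl
    rw [mul_zero, sub_eq_zero] at hM
    have dvd_of_eq : ∀ (G H : Poly3) (c d : ℂ), c ≠ 0 →
        MvPolynomial.C c * H = MvPolynomial.C d * G → G ∣ H := by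
      intro G H c d hc h
      refine ⟨MvPolynomial.C (c⁻¹ * d), ?_⟩
      rw [C_mul, mul_comm G, mul_assoc, ← h, ← mul_assoc, ← C_mul, inv_mul_cancel₀ hc, C_1, one_mul]
    rcases hne with h | h
    · exact not_unit D₁ hD₁ (hrel dvd_rfl (dvd_of_eq _ _ _ _ h hM))
    · exact not_unit D₂ hD₂ (hrel (dvd_of_eq _ _ _ _ h hM.symm) dvd_rfl)
  have hMz : ∀ X ∉ [A, B, C, D, E, F], X ∈ zeroSet D₁ ∩ zeroSet D₂ → eval X.rep M = 0 := by
    intro X hX hXz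
    have h := congrArg (eval X.rep) hM
    have h1 : eval X.rep D₁ = 0 := hXz.1
    have h2 : eval X.rep D₂ = 0 := hXz.2
    simp only [map_sub, map_mul, h1, h2, mul_zero, sub_zero, zero_eq_mul] at h
    exact h.resolve_left fun hXK => not_both X hX hXK hXz
  simp only [List.pairwise_cons, List.mem_cons, List.not_mem_nil, or_false, forall_eq_or_imp,
    forall_eq] at hpair
  have hP : P ∉ [A, B, C, D, E, F] := by simp; grind
  have hQ : Q ∉ [A, B, C, D, E, F] := by simp; grind
  have hPQ : P ≠ Q := by grind
  have hMP := hMz P hP (by simp [hzero])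
  have hMQ := hMz Q hQ (by simp [hzero])
  obtain ⟨f, hf⟩ := exists_dual_eval_eq hMh
  obtain ⟨g, hg⟩ := exists_dual_eval_eq hph
  have hf0 : f ≠ 0 := by
    rintro rfl
    exact hM0 (MvPolynomial.funext fun v => by simp [hf])
  have hg0 : g ≠ 0 := by
    rintro rfl
    exact hp0 (MvPolynomial.funext fun v => by simp [hg])
  refine ⟨hne, M, hMh, hM.symm, fun v => ?_⟩
  rw [hf, hg]
  exact dual_apply_eq_zero_iff hPQ hf0 hg0 (by rw [← hf, hMP]) (by rw [← hf, hMQ])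
    (by rw [← hg]; exact hpP) (by rw [← hg]; exact hpQ) v

/-- **The generalized Steiner–Kirkman point.** If `𝒟₁`, `𝒟₂`, `𝒟₃` are three cubics
through six distinct points on an irreducible conic and `p₁`, `p₂`, `p₃` are the
generalized Pascal lines of the pairs `(𝒟₂,𝒟₃)`, `(𝒟₁,𝒟₃)`, `(𝒟₁,𝒟₂)`, then the three
lines have a common point (they belong to one pencil of lines). -/
theorem generalized_steiner_kirkman_point (A B C D E F : ProjPlane)
    (hdist : ([A, B, C, D, E, F] : List ProjPlane).Pairwise (· ≠ ·))
    (K : Poly3) (hKh : K.IsHomogeneous 2) (hKirr : Irreducible K)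
    (honK : ∀ p ∈ [A, B, C, D, E, F], VanishesAt K p)
    (D₁ D₂ D₃ : Poly3)
    (hD : ∀ Di ∈ [D₁, D₂, D₃], Di ≠ 0 ∧ Di.IsHomogeneous 3 ∧
      ∀ p ∈ [A, B, C, D, E, F], VanishesAt Di p)
    (p₁ p₂ p₃ : Poly3)
    (hp₁ : IsGenPascalLine A B C D E F D₂ D₃ p₁)
    (hp₂ : IsGenPascalLine A B C D E F D₁ D₃ p₂)
    (hp₃ : IsGenPascalLine A B C D E F D₁ D₂ p₃) :
    ∃ X : ProjPlane, VanishesAt p₁ X ∧ VanishesAt p₂ X ∧ VanishesAt p₃ X := by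
  classical
  have hSc : ([A, B, C, D, E, F] : List ProjPlane).toFinset.card = 6 := by
    rw [List.toFinset_card_of_nodup hdist]; rfl
  obtain ⟨T, hTK, hT⟩ := exists_conic_point_notMem hKh hKirr [A, B, C, D, E, F].toFinset
    (by omega) (fun p hp => honK p (List.mem_toFinset.1 hp))
  rw [List.mem_toFinset] at hT
  obtain ⟨-, h1, z1⟩ := hD D₁ (by simp)
  obtain ⟨-, h2, z2⟩ := hD D₂ (by simp)
  obtain ⟨-, h3, z3⟩ := hD D₃ (by simp)
  obtain ⟨hne, M₁, hM₁, e₁, i₁⟩ :=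
    hp₁.exists_conic_mul_eq hdist hKh hKirr honK h2 h3 z2 z3 hTK hT
  obtain ⟨-, M₂, hM₂, e₂, i₂⟩ :=
    hp₂.exists_conic_mul_eq hdist hKh hKirr honK h1 h3 z1 z3 hTK hT
  obtain ⟨-, M₃, hM₃, e₃, i₃⟩ :=
    hp₃.exists_conic_mul_eq hdist hKh hKirr honK h1 h2 z1 z2 hTK hT
  set a := eval T.rep D₁
  set b := eval T.rep D₂
  set c := eval T.rep D₃
  have hdep : MvPolynomial.C a * M₁ + MvPolynomial.C (-b) * M₂ + MvPolynomial.C c * M₃ = 0 := by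
    refine (mul_eq_zero.1 (?_ : K * _ = 0)).resolve_left hKirr.ne_zero
    rw [C_neg]
    linear_combination MvPolynomial.C a * e₁ - MvPolynomial.C b * e₂ + MvPolynomial.C c * e₃
  obtain ⟨f₁, hf₁⟩ := exists_dual_eval_eq hM₁
  obtain ⟨f₂, hf₂⟩ := exists_dual_eval_eq hM₂
  obtain ⟨f₃, hf₃⟩ := exists_dual_eval_eq hM₃
  obtain ⟨v, hv, hv1, hv2, hv3⟩ := exists_ne_zero_of_dual_dependent
    (f₁ := f₁) (f₂ := f₂) (f₃ := f₃) (c₁ := a) (c₂ := -b) (c₃ := c)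
    (.inr (hne.imp_left neg_ne_zero.2)) (fun v => by
      rw [← hf₁, ← hf₂, ← hf₃]
      simpa only [map_add, map_mul, eval_C, map_zero] using congrArg (eval v) hdep)
  obtain ⟨u, hu⟩ := Projectivization.exists_smul_eq_mk_rep ℂ v hv
  refine ⟨Projectivization.mk ℂ v hv, ?_, ?_, ?_⟩ <;> rw [VanishesAt, ← hu, Units.smul_def]
  · rw [← i₁, hf₁, map_smul, hv1, smul_zero]
  · rw [← i₂, hf₂, map_smul, hv2, smul_zero]
  · rw [← i₃, hf₃, map_smul, hv3, smul_zero]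
end
end

section
/- (The classical Steiner point) Let A, B, C, D, E, F be six distinct points of ℙ²(ℂ) on an irreducible conic, no three of them collinear. Assume the Pascal lines of the hexagons ABEDCF, ADEFCB and AFEBCD are all defined, i.e. each of the three pairs of reducible cubics (l(AB)·l(ED)·l(CF), l(BE)·l(DC)·l(FA)), (l(AD)·l(EF)·l(CB), l(DE)·l(FC)·l(BA)) and (l(AF)·l(EB)·l(CD), l(FE)·l(BC)·l(DA)) satisfies the hypotheses for a generalized Pascal line. Then these three Pascal lines pass through a common point. -/
open MvPolynomial

noncomputable section

/-- A linear form is given by a coefficient vector. -/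
theorem exists_dotProduct_of_isHomogeneous_one {L : Poly3} (hL : L.IsHomogeneous 1) :
    ∃ u : Fin 3 → ℂ, ∀ x, eval x L = ∑ i, u i * x i := by
  classical
  have key : ∀ s : Finset (Fin 3 →₀ ℕ), s ⊆ L.support →
      ∃ u : Fin 3 → ℂ, ∀ x, eval x (∑ d ∈ s, monomial d (coeff d L)) = ∑ i, u i * x i := by
    intro s
    induction s using Finset.induction_on with
    | empty => exact fun _ => ⟨0, fun x => by simp⟩
    | insert d s hd ih =>
      intro hs
      obtain ⟨u, hu⟩ := ih fun _ h => hs (Finset.mem_insert_of_mem h)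
      have hdeg : d.degree = 1 := by
        have := hL (mem_support_iff.1 (hs (Finset.mem_insert_self d s)))
        exact (DFunLike.congr_fun Finsupp.degree_eq_weight_one d).trans this
      obtain ⟨i, rfl⟩ := (Finsupp.sum_eq_one_iff d).1 hdeg
      refine ⟨fun j => u j + if j = i then coeff (Finsupp.single i 1) L else 0, fun x => ?_⟩
      rw [Finset.sum_insert hd, map_add, hu]
      simp [eval_monomial, add_mul, Finset.sum_add_distrib, add_comm]
  obtain ⟨u, hu⟩ := key L.support subset_rfl
  exact ⟨u, fun x => by rw [← hu x, ← L.as_sum]⟩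

/-- A quadratic form is given by a coefficient matrix. -/
theorem exists_matrix_of_isHomogeneous_two {K : Poly3} (hK : K.IsHomogeneous 2) :
    ∃ M : Fin 3 → Fin 3 → ℂ, ∀ x, eval x K = ∑ i, ∑ j, M i j * x i * x j := by
  classical
  have key : ∀ s : Finset (Fin 3 →₀ ℕ), s ⊆ K.support →
      ∃ M : Fin 3 → Fin 3 → ℂ,
        ∀ x, eval x (∑ d ∈ s, monomial d (coeff d K)) = ∑ i, ∑ j, M i j * x i * x j := by
    intro s
    induction s using Finset.induction_on with
    | empty => exact fun _ => ⟨0, fun x => by simp⟩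
    | insert d s hd ih =>
      intro hs
      obtain ⟨M, hM⟩ := ih fun _ h => hs (Finset.mem_insert_of_mem h)
      have hdeg : d.degree = 2 := by
        have := hK (mem_support_iff.1 (hs (Finset.mem_insert_self d s)))
        exact (DFunLike.congr_fun Finsupp.degree_eq_weight_one d).trans this
      obtain ⟨i, j, hij⟩ : ∃ i j, ∀ x : Fin 3 → ℂ, (d.prod fun k e => x k ^ e) = x i * x j := by
        have hsum : d 0 + d 1 + d 2 = 2 := by
          rwa [Finsupp.degree_eq_sum, Fin.sum_univ_three] at hdeg
        have hprod (x : Fin 3 → ℂ) :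
            (d.prod fun k e => x k ^ e) = x 0 ^ d 0 * x 1 ^ d 1 * x 2 ^ d 2 := by
          rw [Finsupp.prod_fintype _ _ fun _ => pow_zero _, Fin.prod_univ_three]
        have h0 : d 0 ≤ 2 := by omega
        have h1 : d 1 ≤ 2 := by omega
        have h2 : d 2 = 2 - d 0 - d 1 := by omega
        simp only [hprod, h2]
        generalize d 0 = e at *
        generalize d 1 = f at *
        interval_cases e <;> interval_cases f <;> first
          | omega
          | (refine ⟨2, 2, fun x => ?_⟩; norm_num; ring1)
          | (refine ⟨1, 2, fun x => ?_⟩; norm_num; done)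
          | (refine ⟨1, 1, fun x => ?_⟩; norm_num; ring1)
          | (refine ⟨0, 2, fun x => ?_⟩; norm_num; done)
          | (refine ⟨0, 1, fun x => ?_⟩; norm_num; done)
          | (refine ⟨0, 0, fun x => ?_⟩; norm_num; ring1)
      refine ⟨fun a b => M a b + if a = i then (if b = j then coeff d K else 0) else 0,
        fun x => ?_⟩
      rw [Finset.sum_insert hd, map_add, hM, eval_monomial, hij]
      simp [add_mul, Finset.sum_add_distrib, add_comm, ite_mul, ← mul_assoc]
  obtain ⟨M, hM⟩ := key K.support subset_rfl
  exact ⟨M, fun x => by rw [← hM x, ← K.as_sum]⟩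

/-- Three points are not collinear: no nonzero linear form vanishes at all of them. -/
def NonCollinear (P Q R : ProjPlane) : Prop :=
  ∀ L : Poly3, L ≠ 0 → L.IsHomogeneous 1 → VanishesAt L P → VanishesAt L Q → ¬ VanishesAt L R

theorem NonCollinear.swap₁₂ {P Q R : ProjPlane} (h : NonCollinear P Q R) :
    NonCollinear Q P R :=
  fun L h0 h1 hP hQ hR => h L h0 h1 hQ hP hR

theorem NonCollinear.swap₂₃ {P Q R : ProjPlane} (h : NonCollinear P Q R) :
    NonCollinear P R Q :=
  fun L h0 h1 hP hR hQ => h L h0 h1 hP hQ hR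

theorem IsLineThrough.symm {L : Poly3} {P Q : ProjPlane} (h : IsLineThrough L P Q) :
    IsLineThrough L Q P :=
  ⟨h.1, h.2.1, h.2.2.2, h.2.2.1⟩

theorem eval_add_of_isHomogeneous_one {L : Poly3} (hL : L.IsHomogeneous 1) (x y : Fin 3 → ℂ) :
    eval (x + y) L = eval x L + eval y L := by
  obtain ⟨u, hu⟩ := exists_dotProduct_of_isHomogeneous_one hL
  simp [hu, mul_add, Finset.sum_add_distrib]

theorem eval_smul_of_isHomogeneous_one {L : Poly3} (hL : L.IsHomogeneous 1) (c : ℂ)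
    (x : Fin 3 → ℂ) : eval (c • x) L = c * eval x L := by
  obtain ⟨u, hu⟩ := exists_dotProduct_of_isHomogeneous_one hL
  simp [hu, Finset.mul_sum, mul_left_comm]

/-- Every vector is a combination of representatives of three noncollinear points. -/
theorem NonCollinear.exists_combination {P Q R : ProjPlane} (h : NonCollinear P Q R)
    (x : Fin 3 → ℂ) : ∃ a b c : ℂ, x = a • P.rep + b • Q.rep + c • R.rep := by
  have hdet : (Matrix.of ![P.rep, Q.rep, R.rep]).det ≠ 0 := by
    intro h0
    obtain ⟨u, hu, hz⟩ := Matrix.exists_mulVec_eq_zero_iff.2 h0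
    let L : Poly3 := ∑ i, C (u i) * X i
    have hL : ∀ y, eval y L = ∑ i, u i * y i := fun y => by simp [L]
    refine h L ?_ ?_ ?_ ?_ ?_
    · intro hL0
      apply hu
      funext i
      have := hL (Pi.single i 1)
      simpa [hL0, Pi.single_apply, eq_comm] using this
    · exact IsHomogeneous.sum _ _ _ fun i _ => (isHomogeneous_X ℂ i).C_mul (u i)
    · have := congrFun hz 0
      simpa [VanishesAt, hL, Matrix.mulVec, dotProduct, mul_comm] using this
    · have := congrFun hz 1
      simpa [VanishesAt, hL, Matrix.mulVec, dotProduct, mul_comm] using this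
    · have := congrFun hz 2
      simpa [VanishesAt, hL, Matrix.mulVec, dotProduct, mul_comm] using this
  have hunit := (Matrix.isUnit_iff_isUnit_det _).2 hdet.isUnit
  obtain ⟨c, hc⟩ := Matrix.vecMul_surjective_iff_isUnit.2 hunit x
  refine ⟨c 0, c 1, c 2, ?_⟩
  rw [← hc]
  funext i
  simp [Matrix.vecMul, dotProduct, Fin.sum_univ_three]

/-- A linear form vanishing at two distinct points of a line vanishes on the whole line. -/
theorem eval_eq_zero_of_line {L M : Poly3} (hL0 : L ≠ 0) (hL : L.IsHomogeneous 1)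
    (hM : M.IsHomogeneous 1) {P Q : ProjPlane} (hPQ : P ≠ Q)
    (hLP : VanishesAt L P) (hLQ : VanishesAt L Q) (hMP : VanishesAt M P) (hMQ : VanishesAt M Q)
    {x : Fin 3 → ℂ} (hx : eval x L = 0) : eval x M = 0 := by
  unfold VanishesAt at hLP hLQ hMP hMQ
  obtain ⟨u, hu⟩ := exists_dotProduct_of_isHomogeneous_one hL
  have hu0 : u ≠ 0 := by
    rintro rfl
    exact hL0 (MvPolynomial.funext fun y => by simp [hu])
  have hdet : (Matrix.of ![P.rep, Q.rep, x]).det = 0 := by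
    refine Matrix.exists_mulVec_eq_zero_iff.1 ⟨u, hu0, ?_⟩
    rw [hu] at hLP hLQ hx
    funext i
    fin_cases i <;> simp [Matrix.mulVec, dotProduct, mul_comm _ (u _), hLP, hLQ, hx]
  obtain ⟨c, hc0, hc⟩ := Matrix.exists_vecMul_eq_zero_iff.2 hdet
  have hrel : c 0 • P.rep + c 1 • Q.rep + c 2 • x = 0 := by
    rw [← hc]
    funext i
    simp [Matrix.vecMul, dotProduct, Fin.sum_univ_three]
  have hc2 : c 2 ≠ 0 := by
    intro h2
    have hind := Projectivization.independent_iff.1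
      ((Projectivization.independent_pair_iff_ne _ _).2 hPQ)
    have := Fintype.linearIndependent_iff.1 hind ![c 0, c 1]
      (by simpa [h2, Fin.sum_univ_two] using hrel)
    apply hc0
    funext i
    fin_cases i
    · exact this 0
    · exact this 1
    · exact h2
  have := congrArg (fun y => eval y M) hrel
  simp only [eval_add_of_isHomogeneous_one hM, eval_smul_of_isHomogeneous_one hM, hMP, hMQ] at this
  have h0 : eval (0 : Fin 3 → ℂ) M = 0 := by
    have := eval_smul_of_isHomogeneous_one hM 0 0
    rwa [zero_smul, zero_mul] at this
  rw [h0, mul_zero, mul_zero, zero_add, zero_add] at this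
  exact (mul_eq_zero.1 this).resolve_left hc2

theorem not_isUnit_of_eval_eq_zero {F : Poly3} {x : Fin 3 → ℂ} (h : eval x F = 0) :
    ¬ IsUnit F := fun hF => by
  have := hF.map (eval x)
  rw [h] at this
  exact not_isUnit_zero this

/-- An irreducible conic through the vertices of a quadrangle lies in the pencil spanned by
two pairs of opposite sides, and is neither of these pairs. -/
theorem exists_pencil_eq {K : Poly3} (hKh : K.IsHomogeneous 2) (hKirr : Irreducible K)
    {P Q R S : ProjPlane} (hP : VanishesAt K P) (hQ : VanishesAt K Q) (hR : VanishesAt K R)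
    (hS : VanishesAt K S) (hPQR : NonCollinear P Q R) (hPQS : NonCollinear P Q S)
    (hQRS : NonCollinear Q R S) {lPQ lRS lQR lPS : Poly3}
    (hlPQ : IsLineThrough lPQ P Q) (hlRS : IsLineThrough lRS R S)
    (hlQR : IsLineThrough lQR Q R) (hlPS : IsLineThrough lPS P S) :
    ∃ m n : ℂ, m ≠ 0 ∧ n ≠ 0 ∧ K = C m * (lPQ * lRS) + C n * (lQR * lPS) := by
  have hRS_Q := fun h => hQRS lRS hlRS.1 hlRS.2.1 h hlRS.2.2.1 hlRS.2.2.2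
  have hPS_Q := fun h => hPQS lPS hlPS.1 hlPS.2.1 hlPS.2.2.1 h hlPS.2.2.2
  have hPQ_R := hPQR lPQ hlPQ.1 hlPQ.2.1 hlPQ.2.2.1 hlPQ.2.2.2
  have hPQ_S := hPQS lPQ hlPQ.1 hlPQ.2.1 hlPQ.2.2.1 hlPQ.2.2.2
  have hQR_P := fun h => hPQR lQR hlQR.1 hlQR.2.1 h hlQR.2.2.1 hlQR.2.2.2
  have hQR_S := hQRS lQR hlQR.1 hlQR.2.1 hlQR.2.2.1 hlQR.2.2.2
  obtain ⟨-, hPQ1, hPQ2, hPQ3⟩ := hlPQ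
  obtain ⟨-, hRS1, hRS2, hRS3⟩ := hlRS
  obtain ⟨-, hQR1, hQR2, hQR3⟩ := hlQR
  obtain ⟨-, hPS1, hPS2, hPS3⟩ := hlPS
  unfold VanishesAt at *
  obtain ⟨M, hM⟩ := exists_matrix_of_isHomogeneous_two hKh
  obtain ⟨a, b, c, hK⟩ : ∃ a b c : ℂ, ∀ x y z : ℂ,
      eval (x • P.rep + y • Q.rep + z • R.rep) K = a * (y * z) + b * (x * z) + c * (x * y) := by
    refine ⟨∑ i, ∑ j, M i j * (Q.rep i * R.rep j + R.rep i * Q.rep j),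
      ∑ i, ∑ j, M i j * (P.rep i * R.rep j + R.rep i * P.rep j),
      ∑ i, ∑ j, M i j * (P.rep i * Q.rep j + Q.rep i * P.rep j), fun x y z => ?_⟩
    rw [hM] at hP hQ hR ⊢
    simp only [Fin.sum_univ_three, Pi.add_apply, Pi.smul_apply, smul_eq_mul] at hP hQ hR ⊢
    linear_combination x ^ 2 * hP + y ^ 2 * hQ + z ^ 2 * hR
  obtain ⟨s, t, w, hSe⟩ := hPQR.exists_combination S.rep
  have lin {L : Poly3} (hL : L.IsHomogeneous 1) (x y z : ℂ) :
      eval (x • P.rep + y • Q.rep + z • R.rep) L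
        = x * eval P.rep L + y * eval Q.rep L + z * eval R.rep L := by
    simp only [eval_add_of_isHomogeneous_one hL, eval_smul_of_isHomogeneous_one hL]
  rw [hSe] at hS hRS3 hPS3 hPQ_S hQR_S
  rw [lin hRS1, hRS2] at hRS3
  rw [lin hPS1, hPS2] at hPS3
  rw [lin hPQ1, hPQ2, hPQ3] at hPQ_S
  rw [lin hQR1, hQR2, hQR3] at hQR_S
  rw [hK] at hS
  have hw : w ≠ 0 := by rintro rfl; simp at hPQ_S
  have hs : s ≠ 0 := by rintro rfl; simp at hQR_S
  have hRSP : eval P.rep lRS = -(t * eval Q.rep lRS) / s := by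
    field_simp
    linear_combination hRS3
  have hPSR : eval R.rep lPS = -(t * eval Q.rep lPS) / w := by
    field_simp
    linear_combination hPS3
  have hb : b = -(t * (a * w + c * s)) / (s * w) := by
    field_simp
    linear_combination hS
  have heq : K = C (a / (eval R.rep lPQ * eval Q.rep lRS)) * (lPQ * lRS)
      + C (c / (eval P.rep lQR * eval Q.rep lPS)) * (lQR * lPS) := by
    refine MvPolynomial.funext fun x => ?_
    obtain ⟨x, y, z, rfl⟩ := hPQR.exists_combination x
    rw [map_add, map_mul, map_mul, map_mul, map_mul, eval_C, eval_C, hK, lin hPQ1, lin hRS1, lin hQR1, lin hPS1, hPQ2, hPQ3, hRS2, hQR2, hQR3, hPS2,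
      hRSP, hPSR, hb]
    field_simp
    ring
  have not_mul (k : ℂ) (L₁ L₂ : Poly3) (h₁ : eval P.rep L₁ = 0 ∨ eval Q.rep L₁ = 0)
      (h₂ : eval P.rep L₂ = 0 ∨ eval R.rep L₂ = 0) : K ≠ C k * (L₁ * L₂) := by
    intro h
    rcases hKirr.isUnit_or_isUnit (h.trans (mul_assoc _ _ _).symm) with hu | hu
    · rcases h₁ with h₁ | h₁ <;>
        exact not_isUnit_of_eval_eq_zero h₁ (isUnit_of_mul_isUnit_right hu)
    · rcases h₂ with h₂ | h₂ <;> exact not_isUnit_of_eval_eq_zero h₂ hu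
  refine ⟨_, _, fun h => ?_, fun h => ?_, heq⟩
  · rw [h, C_0, zero_mul, zero_add] at heq
    exact not_mul _ _ _ (.inr hQR2) (.inl hPS2) heq
  · rw [h, C_0, zero_mul, add_zero] at heq
    exact not_mul _ _ _ (.inl hPQ2) (.inr hRS2) heq

/-- A chord of a conic meets it in no further point. -/
theorem not_vanishesAt_of_chord {K lPQ lRS lQR lPS : Poly3} {P Q R S Z : ProjPlane} {m n : ℂ}
    (hn : n ≠ 0) (hK : K = C m * (lPQ * lRS) + C n * (lQR * lPS))
    (hPQR : NonCollinear P Q R) (hPQS : NonCollinear P Q S)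
    (hlPQ : IsLineThrough lPQ P Q) (hlQR : IsLineThrough lQR Q R) (hlPS : IsLineThrough lPS P S)
    (hZP : P ≠ Z) (hZQ : Q ≠ Z) (hZ : VanishesAt lPQ Z) : ¬ VanishesAt K Z := by
  intro hKZ
  have h : VanishesAt lQR Z ∨ VanishesAt lPS Z := by
    unfold VanishesAt at *
    simpa [hK, hZ, hn] using hKZ
  rcases h with h | h
  · exact hPQR lQR hlQR.1 hlQR.2.1 (eval_eq_zero_of_line hlPQ.1 hlPQ.2.1 hlQR.2.1 hZQ
      hlPQ.2.2.2 hZ hlQR.2.2.1 h hlPQ.2.2.1) hlQR.2.2.1 hlQR.2.2.2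
  · exact hPQS lPS hlPS.1 hlPS.2.1 hlPS.2.2.1 (eval_eq_zero_of_line hlPQ.1 hlPQ.2.1 hlPS.2.1 hZP
      hlPQ.2.2.1 hZ hlPS.2.2.1 h hlPQ.2.2.2) hlPS.2.2.2

/-- If a combination of two cubics splits off a curve which avoids the further intersection
points, the residual line is their generalized Pascal line. -/
theorem IsGenPascalLine.eval_eq_zero {A B C' D E F : ProjPlane} {D₁ D₂ L K N : Poly3}
    (h : IsGenPascalLine A B C' D E F D₁ D₂ L) (hN : N.IsHomogeneous 1) {α β : ℂ} (hα : α ≠ 0)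
    (hKN : C α * D₁ = K * N + C β * D₂)
    (hK : ∀ Z, A ≠ Z → B ≠ Z → C' ≠ Z → D ≠ Z → E ≠ Z → F ≠ Z → VanishesAt D₁ Z →
      ¬ VanishesAt K Z)
    {x : Fin 3 → ℂ} (hx : eval x N = 0) : eval x L = 0 := by
  obtain ⟨hrel, -, hL, P, Q, R, hne, hzero, hLP, hLQ, -⟩ := h
  simp only [List.pairwise_cons, List.mem_cons, forall_eq_or_imp] at hne
  have mem (Z : ProjPlane) (hZ : Z ∈ ({A, B, C', D, E, F, P, Q, R} : Set ProjPlane)) :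
      VanishesAt D₁ Z ∧ VanishesAt D₂ Z := by
    rw [← hzero] at hZ
    exact hZ
  have hN0 : N ≠ 0 := by
    rintro rfl
    refine not_isUnit_of_eval_eq_zero (mem A (by simp)).2 (hrel (d := D₂) ?_ dvd_rfl)
    refine ⟨C (α⁻¹ * β), ?_⟩
    rw [mul_zero, zero_add] at hKN
    rw [C_mul, mul_comm, mul_assoc, ← hKN, ← mul_assoc, ← C_mul, inv_mul_cancel₀ hα, C_1, one_mul]
  have residual (Z : ProjPlane) (h₁ : VanishesAt D₁ Z) (h₂ : VanishesAt D₂ Z)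
      (hKZ : ¬ VanishesAt K Z) : VanishesAt N Z := by
    unfold VanishesAt at *
    have := congrArg (eval Z.rep) hKN
    simpa [h₁, h₂, hKZ] using this
  have hP := mem P (by simp)
  have hQ := mem Q (by simp)
  have hNP := residual P hP.1 hP.2 (hK P (by tauto) (by tauto) (by tauto) (by tauto) (by tauto)
    (by tauto) hP.1)
  have hNQ := residual Q hQ.1 hQ.2 (hK Q (by tauto) (by tauto) (by tauto) (by tauto) (by tauto)
    (by tauto) hQ.1)
  exact eval_eq_zero_of_line hN0 hN hL (by tauto) hNP hNQ hLP hLQ hx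

theorem IsGenPascalLine.symm {A B C D E F : ProjPlane} {D₁ D₂ L : Poly3}
    (h : IsGenPascalLine A B C D E F D₁ D₂ L) : IsGenPascalLine A B C D E F D₂ D₁ L := by
  obtain ⟨hrel, h0, h1, P, Q, R, hne, hzero, h⟩ := h
  exact ⟨hrel.symm, h0, h1, P, Q, R, hne, by rwa [Set.inter_comm], h⟩

/-- Two lines in the projective plane meet. -/
theorem exists_common_zero {L M : Poly3} (hL : L.IsHomogeneous 1) (hM : M.IsHomogeneous 1) :
    ∃ x : Fin 3 → ℂ, x ≠ 0 ∧ eval x L = 0 ∧ eval x M = 0 := by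
  obtain ⟨u, hu⟩ := exists_dotProduct_of_isHomogeneous_one hL
  obtain ⟨v, hv⟩ := exists_dotProduct_of_isHomogeneous_one hM
  obtain ⟨x, hx0, hx⟩ := Matrix.exists_mulVec_eq_zero_iff.2
    (Matrix.det_eq_zero_of_row_eq_zero (A := Matrix.of ![u, v, 0]) 2 fun _ => rfl)
  exact ⟨x, hx0, by simpa [hu, Matrix.mulVec, dotProduct] using congrFun hx 0,
    by simpa [hv, Matrix.mulVec, dotProduct] using congrFun hx 1⟩

theorem vanishesAt_mk {L : Poly3} (hL : L.IsHomogeneous 1) {x : Fin 3 → ℂ} (hx : x ≠ 0)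
    (h : eval x L = 0) : VanishesAt L (Projectivization.mk ℂ x hx) := by
  obtain ⟨a, ha⟩ := Projectivization.exists_smul_eq_mk_rep ℂ x hx
  rw [VanishesAt, ← ha, Units.smul_def, eval_smul_of_isHomogeneous_one hL, h, mul_zero]

theorem vanishesAt_mul {L M : Poly3} {Z : ProjPlane} :
    VanishesAt (L * M) Z ↔ VanishesAt L Z ∨ VanishesAt M Z := by
  simp [VanishesAt]

/-- **The classical Steiner point.** The Pascal lines of the hexagons `ABEDCF`, `ADEFCB`
and `AFEBCD` inscribed in an irreducible conic pass through a common point. -/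
theorem classical_steiner_point (A B C D E F : ProjPlane)
    (hdist : ([A, B, C, D, E, F] : List ProjPlane).Pairwise (· ≠ ·))
    (K : Poly3) (hKh : K.IsHomogeneous 2) (hKirr : Irreducible K)
    (honK : ∀ p ∈ [A, B, C, D, E, F], VanishesAt K p)
    (hn3 : NoThreeCollinear {A, B, C, D, E, F})
    (lAB lBE lDE lCD lCF lAF lAD lEF lBC : Poly3)
    (hlAB : IsLineThrough lAB A B) (hlBE : IsLineThrough lBE B E)
    (hlDE : IsLineThrough lDE D E) (hlCD : IsLineThrough lCD C D)
    (hlCF : IsLineThrough lCF C F) (hlAF : IsLineThrough lAF A F)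
    (hlAD : IsLineThrough lAD A D) (hlEF : IsLineThrough lEF E F)
    (hlBC : IsLineThrough lBC B C)
    (p₁ p₂ p₃ : Poly3)
    (hp₁ : IsGenPascalLine A B C D E F (lAB * lDE * lCF) (lBE * lCD * lAF) p₁)
    (hp₂ : IsGenPascalLine A B C D E F (lAD * lEF * lBC) (lDE * lCF * lAB) p₂)
    (hp₃ : IsGenPascalLine A B C D E F (lAF * lBE * lCD) (lEF * lBC * lAD) p₃) :
    ∃ X : ProjPlane, VanishesAt p₁ X ∧ VanishesAt p₂ X ∧ VanishesAt p₃ X := by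
  have hL₁ := hp₁.2.2.1
  have hL₂ := hp₂.2.2.1
  have hL₃ := hp₃.2.2.1
  have nc {P Q R : ProjPlane} (hP : P ∈ ({A, B, C, D, E, F} : Set ProjPlane))
      (hQ : Q ∈ ({A, B, C, D, E, F} : Set ProjPlane))
      (hR : R ∈ ({A, B, C, D, E, F} : Set ProjPlane)) (hPQ : P ≠ Q) (hPR : P ≠ R)
      (hQR : Q ≠ R) : NonCollinear P Q R := fun L h0 h1 h2 h3 h4 =>
    hn3 P Q R hP hQ hR hPQ hPR hQR ⟨L, h0, h1, by
      rintro p (rfl | rfl | rfl) <;> assumption⟩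
  simp only [List.pairwise_cons, List.mem_cons, forall_eq_or_imp, List.not_mem_nil,
    IsEmpty.forall_iff, implies_true, and_true, List.Pairwise.nil, ne_eq] at hdist
  obtain ⟨⟨hAB, hAC, hAD, hAE, hAF⟩, ⟨hBC, hBD, hBE, hBF⟩, ⟨hCD, hCE, hCF⟩, ⟨hDE, hDF⟩, hEF⟩ :=
    hdist
  have hABE : NonCollinear A B E := nc (by simp) (by simp) (by simp) hAB hAE hBE
  have hABD : NonCollinear A B D := nc (by simp) (by simp) (by simp) hAB hAD hBD
  have hBDE : NonCollinear B D E := nc (by simp) (by simp) (by simp) hBD hBE hDE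
  have hADE : NonCollinear A D E := nc (by simp) (by simp) (by simp) hAD hAE hDE
  have hACD : NonCollinear A C D := nc (by simp) (by simp) (by simp) hAC hAD hCD
  have hADF : NonCollinear A D F := nc (by simp) (by simp) (by simp) hAD hAF hDF
  have hCDF : NonCollinear C D F := nc (by simp) (by simp) (by simp) hCD hCF hDF
  have hACF : NonCollinear A C F := nc (by simp) (by simp) (by simp) hAC hAF hCF
  have hBCF : NonCollinear B C F := nc (by simp) (by simp) (by simp) hBC hBF hCF
  have hBCE : NonCollinear B C E := nc (by simp) (by simp) (by simp) hBC hBE hCE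
  have hCEF : NonCollinear C E F := nc (by simp) (by simp) (by simp) hCE hCF hEF
  simp only [List.mem_cons, forall_eq_or_imp, List.not_mem_nil, IsEmpty.forall_iff,
    implies_true, and_true] at honK
  obtain ⟨kA, kB, kC, kD, kE, kF⟩ := honK
  obtain ⟨m₁, n₁, hm₁, hn₁, hK₁⟩ := exists_pencil_eq hKh hKirr kA kB kE kD hABE hABD
    hBDE.swap₂₃ hlAB hlDE.symm hlBE hlAD
  obtain ⟨m₂, n₂, hm₂, hn₂, hK₂⟩ := exists_pencil_eq hKh hKirr kA kD kC kF hACD.swap₂₃ hADF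
    hCDF.swap₁₂ hlAD hlCF hlCD.symm hlAF
  obtain ⟨m₃, n₃, hm₃, hn₃, hK₃⟩ := exists_pencil_eq hKh hKirr kB kC kF kE hBCF hBCE
    hCEF.swap₂₃ hlBC hlEF.symm hlCF hlBE
  have off₁ (Z : ProjPlane) (zA : A ≠ Z) (zB : B ≠ Z) (zC : C ≠ Z) (zD : D ≠ Z) (zE : E ≠ Z)
      (zF : F ≠ Z) (hZ : VanishesAt (lAB * lDE * lCF) Z) : ¬ VanishesAt K Z := by
    rw [vanishesAt_mul, vanishesAt_mul] at hZ
    rcases hZ with (hZ | hZ) | hZ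
    · exact not_vanishesAt_of_chord hn₁ hK₁ hABE hABD hlAB hlBE hlAD zA zB hZ
    · exact not_vanishesAt_of_chord (P := D) (Q := E) (R := B) (S := A) hn₁
        (by rw [hK₁]; ring) hBDE.swap₁₂.swap₂₃ hADE.swap₁₂.swap₂₃ hlDE hlBE.symm hlAD.symm
        zD zE hZ (lPQ := lDE) (lRS := lAB) (m := m₁)
    · exact not_vanishesAt_of_chord (P := C) (Q := F) (R := A) (S := D) hn₂
        (by rw [hK₂]; ring) hACF.swap₁₂.swap₂₃ hCDF.swap₂₃ hlCF hlAF.symm hlCD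
        zC zF hZ (lPQ := lCF) (lRS := lAD) (m := m₂)
  have off₂ (Z : ProjPlane) (zA : A ≠ Z) (zB : B ≠ Z) (zC : C ≠ Z) (zD : D ≠ Z) (zE : E ≠ Z)
      (zF : F ≠ Z) (hZ : VanishesAt (lAF * lBE * lCD) Z) : ¬ VanishesAt K Z := by
    rw [vanishesAt_mul, vanishesAt_mul] at hZ
    rcases hZ with (hZ | hZ) | hZ
    · exact not_vanishesAt_of_chord (P := A) (Q := F) (R := C) (S := D) hm₂
        (by rw [hK₂]; ring) hACF.swap₂₃ hADF.swap₂₃ hlAF hlCF.symm hlAD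
        zA zF hZ (lPQ := lAF) (lRS := lCD) (m := n₂)
    · exact not_vanishesAt_of_chord (P := B) (Q := E) (R := D) (S := A) hm₁
        (by rw [hK₁]; ring) hBDE.swap₂₃ hABE.swap₁₂.swap₂₃ hlBE hlDE.symm hlAB.symm
        zB zE hZ (lPQ := lBE) (lRS := lAD) (m := n₁)
    · exact not_vanishesAt_of_chord (P := C) (Q := D) (R := A) (S := F) hm₂
        (by rw [hK₂]; ring) hACD.swap₁₂.swap₂₃ hCDF hlCD hlAD.symm hlCF
        zC zD hZ (lPQ := lCD) (lRS := lAF) (m := n₂)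
  have hN₁ : (MvPolynomial.C m₂ * lCF - MvPolynomial.C n₁ * lBE).IsHomogeneous 1 :=
    (hlCF.2.1.C_mul _).sub (hlBE.2.1.C_mul _)
  have hN₂ : (MvPolynomial.C n₃ * lCF - MvPolynomial.C n₁ * lAD).IsHomogeneous 1 :=
    (hlCF.2.1.C_mul _).sub (hlAD.2.1.C_mul _)
  have hN₃ : (MvPolynomial.C n₃ * lBE - MvPolynomial.C m₂ * lAD).IsHomogeneous 1 :=
    (hlBE.2.1.C_mul _).sub (hlAD.2.1.C_mul _)
  obtain ⟨x, hx0, hx₂, hx₃⟩ := exists_common_zero hN₂ hN₃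
  have hx₁ : eval x (MvPolynomial.C m₂ * lCF - MvPolynomial.C n₁ * lBE) = 0 := by
    simp only [map_sub, map_mul, eval_C] at hx₂ hx₃ ⊢
    refine (mul_eq_zero.1 ?_).resolve_left hn₃
    linear_combination m₂ * hx₂ - n₁ * hx₃
  have e₁ : eval x p₁ = 0 := hp₁.eval_eq_zero hN₁ (mul_ne_zero hm₁ hm₂) (β := n₁ * n₂)
    (by
      simp only [C_mul]
      linear_combination -(MvPolynomial.C m₂ * lCF) * hK₁ + MvPolynomial.C n₁ * lBE * hK₂) off₁ hx₁
  have e₂ : eval x p₂ = 0 := by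
    have h := hp₂.symm
    rw [show lDE * lCF * lAB = lAB * lDE * lCF by ring] at h
    refine h.eval_eq_zero hN₂ (mul_ne_zero hm₁ hn₃) (β := n₁ * m₃) ?_ off₁ hx₂
    simp only [C_mul]
    linear_combination -(MvPolynomial.C n₃ * lCF) * hK₁ + MvPolynomial.C n₁ * lAD * hK₃
  have e₃ : eval x p₃ = 0 := hp₃.eval_eq_zero hN₃ (mul_ne_zero hn₂ hn₃) (β := m₂ * m₃)
    (by
      simp only [C_mul]
      linear_combination -(MvPolynomial.C n₃ * lBE) * hK₂ + MvPolynomial.C m₂ * lAD * hK₃) off₂ hx₃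
  exact ⟨_, vanishesAt_mk hL₁ hx0 e₁, vanishesAt_mk hL₂ hx0 e₂, vanishesAt_mk hL₃ hx0 e₃⟩
end
end
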